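/- arXiv:2503.23845 — 6 statements merged into one kernel-verified Lean document; each statement's English description precedes it below -/
import Mathlib

section
/- Let n ≥ 5, let G = Sₙ be the symmetric group on {1,…,n}, and let H = A_{n−1} be the subgroup of all even permutations that fix the letter n. Then the base size of G on G/H equals n − 2: there exist g₁, …, g_{n−2} ∈ G with ⋂_{i=1}^{n−2} g_iHg_i⁻¹ trivial, but for any g₁, …, g_{n−3} ∈ G the intersection ⋂_{i=1}^{n−3} g_iHg_i⁻¹ is nontrivial. -/
noncomputable section

/-- The usual inner product of class functions on a finite group `H`. -/
def charInner (H : Type) (φ ψ : H → ℂ) : ℂ :=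
  (Nat.card H : ℂ)⁻¹ * ∑ᶠ h : H, φ h * (starRingEnd ℂ) (ψ h)

/-- `χ : H → ℂ` is the character of an irreducible complex representation of `H`. -/
def IsIrrChar (H : Type) [Group H] (χ : H → ℂ) : Prop :=
  ∃ V : FDRep ℂ H, CategoryTheory.Simple V ∧ χ = V.character

/-- Restriction of a class function on `G` to a subgroup `H`. -/
def resChar {G : Type} [Group G] (H : Subgroup G) (χ : G → ℂ) : ↥H → ℂ :=
  fun h => χ (h : G)

/-- Two irreducible characters `α, β` of a subgroup `H ≤ G` are linked over `G` if some
irreducible character `χ` of `G` satisfies `⟨χ|_H, α⟩ ≠ 0` and `⟨χ|_H, β⟩ ≠ 0`. -/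
def Linked {G : Type} [Group G] (H : Subgroup G) (α β : ↥H → ℂ) : Prop :=
  ∃ χ : G → ℂ, IsIrrChar G χ ∧
    charInner ↥H (resChar H χ) α ≠ 0 ∧ charInner ↥H (resChar H χ) β ≠ 0

/-- `α` and `β` are joined by a path of length at most `m` in the Külshammer graph
`K(G,H)`: there is a chain of irreducible characters of `H`, of length `k ≤ m`, from `α`
to `β` in which consecutive members are linked over `G`. -/
def LinkedPathLE {G : Type} [Group G] (H : Subgroup G) (m : ℕ) (α β : ↥H → ℂ) : Prop :=
  ∃ k ≤ m, ∃ f : ℕ → (↥H → ℂ), f 0 = α ∧ f k = β ∧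
    (∀ i ≤ k, IsIrrChar ↥H (f i)) ∧ ∀ i < k, Linked H (f i) (f (i + 1))

/-- The conjugate subgroup `g H g⁻¹`. -/
def conjSub {G : Type} [Group G] (g : G) (H : Subgroup G) : Subgroup G :=
  H.map (MulAut.conj g).toMonoidHom

theorem mem_conjSub_alternating_inf_stabilizer {α : Type} [Fintype α] [DecidableEq α]
    (g x : Equiv.Perm α) (a : α) :
    x ∈ conjSub g (alternatingGroup α ⊓ MulAction.stabilizer (Equiv.Perm α) a) ↔
      Equiv.Perm.sign x = 1 ∧ x (g a) = g a := by
  rw [conjSub, Subgroup.mem_map_equiv, Subgroup.mem_inf, Equiv.Perm.mem_alternatingGroup,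
    MulAction.mem_stabilizer_iff, MulAut.conj_symm_apply, Equiv.Perm.smul_def,
    Equiv.Perm.mul_apply, Equiv.Perm.mul_apply, Equiv.Perm.inv_eq_iff_eq]
  simp [mul_right_comm]

/-- An even permutation moving at most two points is trivial. -/
theorem eq_one_of_sign_eq_one_of_card_support_le_two {α : Type} [Fintype α] [DecidableEq α]
    {x : Equiv.Perm α} (hx : Equiv.Perm.sign x = 1) (h : x.support.card ≤ 2) : x = 1 := by
  by_contra hne
  have h2 : x.support.card = 2 := le_antisymm h (Equiv.Perm.two_le_card_support_of_ne_one hne)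
  have hs := (Equiv.Perm.card_support_eq_two.mp h2).sign_eq
  rw [hx] at hs
  exact absurd hs (by decide)

/-- Let `n ≥ 5`, `G = Sₙ` and let `H = A_{n-1}` be the group of even
permutations fixing a given letter. Then `b(G,H) = n - 2`: some `n - 2` conjugates of `H`
intersect trivially, but no `n - 3` conjugates do. -/
theorem base_size_An_minus_one (n : ℕ) (hn : 5 ≤ n) (a : Fin n)
    (H : Subgroup (Equiv.Perm (Fin n)))
    (hH : H = alternatingGroup (Fin n) ⊓ MulAction.stabilizer (Equiv.Perm (Fin n)) a) :
    (∃ g : Fin (n - 2) → Equiv.Perm (Fin n), (⨅ i, conjSub (g i) H) = ⊥) ∧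
    ∀ g : Fin (n - 3) → Equiv.Perm (Fin n), (⨅ i, conjSub (g i) H) ≠ ⊥ := by
  subst hH
  constructor
  · refine ⟨fun i => Equiv.swap a (Fin.castLE (Nat.sub_le n 2) i), ?_⟩
    rw [eq_bot_iff]
    intro x hx
    simp only [Subgroup.mem_iInf, mem_conjSub_alternating_inf_stabilizer,
      Equiv.swap_apply_left] at hx
    rw [Subgroup.mem_bot]
    refine eq_one_of_sign_eq_one_of_card_support_le_two (hx ⟨0, by omega⟩).1 ?_
    have hsub : x.support ⊆ {⟨n - 2, by omega⟩, ⟨n - 1, by omega⟩} := by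
      intro j hj
      rw [Equiv.Perm.mem_support] at hj
      have hjn : ¬ (j : ℕ) < n - 2 := fun hlt => hj (hx ⟨j, hlt⟩).2
      have := j.isLt
      simp only [Finset.mem_insert, Finset.mem_singleton, Fin.ext_iff]
      omega
    exact (Finset.card_le_card hsub).trans Finset.card_le_two
  · intro g hbot
    have hS : (Finset.univ.image fun i => g i a).card ≤ n - 3 := by
      simpa using Finset.card_image_le (s := Finset.univ) (f := fun i => g i a)
    have hC : 2 < ((Finset.univ.image fun i => g i a)ᶜ).card := by
      rw [Finset.card_compl, Fintype.card_fin]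
      omega
    obtain ⟨u, v, w, hu, hv, hw, huv, huw, hvw⟩ := Finset.two_lt_card_iff.mp hC
    simp only [Finset.mem_compl, Finset.mem_image, Finset.mem_univ, true_and,
      not_exists] at hu hv hw
    have hmem : Equiv.swap u v * Equiv.swap v w ∈ ⨅ i, conjSub (g i)
        (alternatingGroup (Fin n) ⊓ MulAction.stabilizer (Equiv.Perm (Fin n)) a) := by
      simp only [Subgroup.mem_iInf, mem_conjSub_alternating_inf_stabilizer]
      intro i
      constructor
      · simp [Equiv.Perm.sign_swap huv, Equiv.Perm.sign_swap hvw]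
      · rw [Equiv.Perm.mul_apply, Equiv.swap_apply_of_ne_of_ne (hv i) (hw i),
          Equiv.swap_apply_of_ne_of_ne (hu i) (hv i)]
    rw [hbot, Subgroup.mem_bot] at hmem
    have happ := Equiv.congr_fun hmem w
    rw [Equiv.Perm.mul_apply, Equiv.swap_apply_right, Equiv.swap_apply_right,
      Equiv.Perm.one_apply] at happ
    exact huw happ
end
end

section
/- Let n ≥ 5, let G = Aₙ be the alternating group on {1,…,n}, and let H be the pointwise stabilizer in G of two distinct letters (so H is isomorphic to A_{n−2}). Then the base size of G on G/H equals ⌊(n−1)/2⌋: there exist g₁, …, g_{⌊(n−1)/2⌋} ∈ G with ⋂_i g_iHg_i⁻¹ trivial, and no smaller number of conjugates of H has trivial intersection. -/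
noncomputable section

theorem mem_conjSub_iff {G : Type} [Group G] (g x : G) (H : Subgroup G) :
    x ∈ conjSub g H ↔ g⁻¹ * x * g ∈ H := by
  constructor
  · rintro ⟨h, hh, rfl⟩
    simpa [mul_assoc] using hh
  · exact fun hx => ⟨g⁻¹ * x * g, hx, by simp [mul_assoc]⟩

/-- If `H` is the pointwise stabilizer of `a` and `b`, then `⨅ i, g i H (g i)⁻¹` is the pointwise
stabilizer of all the letters `g i a` and `g i b`. -/
theorem mem_iInf_conjSub_iff {α : Type} [Fintype α] [DecidableEq α] {a b : α}
    {H : Subgroup ↥(alternatingGroup α)}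
    (hH : ∀ g : ↥(alternatingGroup α), g ∈ H ↔
      (g : Equiv.Perm α) a = a ∧ (g : Equiv.Perm α) b = b)
    {ι : Type} (g : ι → ↥(alternatingGroup α)) (x : ↥(alternatingGroup α)) :
    x ∈ (⨅ i, conjSub (g i) H) ↔ ∀ i,
      (x : Equiv.Perm α) ((g i : Equiv.Perm α) a) = (g i : Equiv.Perm α) a ∧
      (x : Equiv.Perm α) ((g i : Equiv.Perm α) b) = (g i : Equiv.Perm α) b := by
  simp [Subgroup.mem_iInf, mem_conjSub_iff, hH, Equiv.symm_apply_eq]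

theorem exists_alternatingGroup_apply_eq {α : Type} [Fintype α] [DecidableEq α]
    (hα : 4 ≤ Nat.card α) {a b c d : α} (hab : a ≠ b) (hcd : c ≠ d) :
    ∃ g : ↥(alternatingGroup α), (g : Equiv.Perm α) a = c ∧ (g : Equiv.Perm α) b = d := by
  have := alternatingGroup.isMultiplyPretransitive α
  have h : MulAction.IsMultiplyPretransitive ↥(alternatingGroup α) α 2 :=
    MulAction.isMultiplyPretransitive_of_le (n := Nat.card α - 2) (by omega) (Nat.sub_le _ _)
  exact MulAction.is_two_pretransitive_iff.mp h hab hcd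

/-- An even permutation moving at most two letters is the identity. -/
theorem eq_one_of_mem_alternatingGroup_of_card_support_le_two {α : Type} [Fintype α]
    [DecidableEq α] {σ : Equiv.Perm α} (hσ : σ ∈ alternatingGroup α)
    (h : σ.support.card ≤ 2) : σ = 1 := by
  rcases h.lt_or_eq with h | h
  · exact Equiv.Perm.card_support_le_one.mp (by omega)
  · have hs := (Equiv.Perm.card_support_eq_two.mp h).sign_eq
    rw [Equiv.Perm.mem_alternatingGroup.mp hσ] at hs
    exact absurd hs (by decide)

/-- A set of letters missing at least three letters is fixed by a nontrivial even permutation. -/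
theorem exists_ne_one_forall_mem_apply_eq {α : Type} [Fintype α] [DecidableEq α]
    (s : Finset α) (hs : s.card + 3 ≤ Fintype.card α) :
    ∃ g : ↥(alternatingGroup α), g ≠ 1 ∧ ∀ x ∈ s, (g : Equiv.Perm α) x = x := by
  have hc : 2 < sᶜ.card := by rw [Finset.card_compl]; omega
  obtain ⟨x, y, z, hx, hy, hz, hxy, hxz, hyz⟩ := Finset.two_lt_card_iff.mp hc
  rw [Finset.mem_compl] at hx hy hz
  refine ⟨⟨Equiv.swap x y * Equiv.swap x z, ?_⟩, ?_, ?_⟩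
  · simp [Equiv.Perm.mem_alternatingGroup, Equiv.Perm.sign_swap hxy, Equiv.Perm.sign_swap hxz]
  · intro h
    have := congrArg (fun g : ↥(alternatingGroup α) => (g : Equiv.Perm α) x) h
    simp [Equiv.swap_apply_of_ne_of_ne hxz.symm hyz.symm, hxz.symm] at this
  · intro w hw
    have hwx : w ≠ x := fun h => hx (h ▸ hw)
    have hwy : w ≠ y := fun h => hy (h ▸ hw)
    have hwz : w ≠ z := fun h => hz (h ▸ hw)
    simp [Equiv.swap_apply_of_ne_of_ne, hwx, hwy, hwz]

/-- Let `n ≥ 5`, `G = Aₙ`, and let `H` be the pointwise stabilizer in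
`G` of two distinct letters `a, b`. Then `b(G,H) = ⌊(n-1)/2⌋`: some `⌊(n-1)/2⌋` conjugates
of `H` intersect trivially, and no smaller number of conjugates of `H` does. -/
theorem base_size_An_minus_two (n : ℕ) (hn : 5 ≤ n) (a b : Fin n) (hab : a ≠ b)
    (H : Subgroup ↥(alternatingGroup (Fin n)))
    (hH : ∀ g : ↥(alternatingGroup (Fin n)), g ∈ H ↔
      (g : Equiv.Perm (Fin n)) a = a ∧ (g : Equiv.Perm (Fin n)) b = b) :
    (∃ g : Fin ((n - 1) / 2) → ↥(alternatingGroup (Fin n)), (⨅ i, conjSub (g i) H) = ⊥) ∧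
    ∀ k < (n - 1) / 2, ∀ g : Fin k → ↥(alternatingGroup (Fin n)),
      (⨅ i, conjSub (g i) H) ≠ ⊥ := by
  constructor
  · have hg : ∀ i : Fin ((n - 1) / 2), ∃ g : ↥(alternatingGroup (Fin n)),
        (g : Equiv.Perm (Fin n)) a = ⟨2 * i, by omega⟩ ∧
        (g : Equiv.Perm (Fin n)) b = ⟨2 * i + 1, by omega⟩ := fun i =>
      exists_alternatingGroup_apply_eq (by rw [Nat.card_fin]; omega) hab (by simp)
    choose g hga hgb using hg
    refine ⟨g, (Subgroup.eq_bot_iff_forall _).mpr fun x hx => ?_⟩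
    rw [mem_iInf_conjSub_iff hH] at hx
    refine Subtype.ext (eq_one_of_mem_alternatingGroup_of_card_support_le_two x.2 ?_)
    have hsub : (x : Equiv.Perm (Fin n)).support ⊆
        {⟨n - 2, by omega⟩, ⟨n - 1, by omega⟩} := by
      intro j hj
      rw [Equiv.Perm.mem_support] at hj
      by_contra hj'
      simp only [Finset.mem_insert, Finset.mem_singleton, Fin.ext_iff, not_or] at hj'
      obtain ⟨hxa, hxb⟩ := hx ⟨j / 2, by omega⟩
      rw [hga] at hxa
      rw [hgb] at hxb
      rcases Nat.mod_two_eq_zero_or_one j with h | h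
      · have e : (⟨2 * (j / 2), by omega⟩ : Fin n) = j := Fin.ext (by simp only; omega)
        exact hj (e ▸ hxa)
      · have e : (⟨2 * (j / 2) + 1, by omega⟩ : Fin n) = j := Fin.ext (by simp only; omega)
        exact hj (e ▸ hxb)
    exact (Finset.card_le_card hsub).trans Finset.card_le_two
  · intro k hk g hbot
    have hcard (c : Fin n) :
        (Finset.univ.image fun i => (g i : Equiv.Perm (Fin n)) c).card ≤ k :=
      Finset.card_image_le.trans (by simp)
    obtain ⟨x, hx1, hx⟩ := exists_ne_one_forall_mem_apply_eq
      ((Finset.univ.image fun i => (g i : Equiv.Perm (Fin n)) a) ∪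
        Finset.univ.image fun i => (g i : Equiv.Perm (Fin n)) b) (by
      have := Finset.card_union_le (Finset.univ.image fun i => (g i : Equiv.Perm (Fin n)) a)
        (Finset.univ.image fun i => (g i : Equiv.Perm (Fin n)) b)
      have := hcard a
      have := hcard b
      rw [Fintype.card_fin]
      omega)
    refine hx1 ((Subgroup.eq_bot_iff_forall _).mp hbot x ?_)
    rw [mem_iInf_conjSub_iff hH]
    exact fun i => ⟨hx _ (by simp), hx _ (by simp)⟩
end
end

section
/- Let n ≥ 5, let G = GLₙ(𝔽₂) be the general linear group of degree n over the field with two elements (so G is the nonabelian simple group Lₙ(2)), and let H be the stabilizer in G of a 1-dimensional subspace of 𝔽₂ⁿ (a maximal parabolic subgroup of type P₁). Then there exist irreducible complex characters α, β of H that are not linked over G: no irreducible complex character χ of G satisfies both ⟨χ|_H, α⟩ ≠ 0 and ⟨χ|_H, β⟩ ≠ 0 (equivalently, the induced characters α^G and β^G have no common irreducible constituent, so d_G(H) ≥ 5). -/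
noncomputable section

open Representation in
/-- The character of an irreducible finite-dimensional representation is irreducible. -/
theorem isIrrChar_of_isIrreducible {H V : Type} [Group H] [Finite H] [AddCommGroup V] [Module ℂ V]
    [FiniteDimensional ℂ V] (ρ : Representation ℂ H V) [IsIrreducible ρ] :
    IsIrrChar H ρ.character := by
  have := Fintype.ofFinite H
  have := invertibleOfNonzero (NeZero.ne (Nat.card H : ℂ))
  refine ⟨FDRep.of ρ, ?_, rfl⟩
  rw [FDRep.simple_iff_char_is_norm_one]
  have h := card_inv_mul_sum_char_mul_char_eq_finrank ρ ρ
  rw [IsIrreducible.finrank_intertwiningMap_self] at h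
  rw [inv_mul_eq_one₀ (NeZero.ne _) |>.mp (h.trans Nat.cast_one)]
  rfl

open Matrix in
/-- The irreducible characters are stable under `χ ↦ (h ↦ conj (χ h⁻¹))`, realized by the
conjugate transposes of the inverse matrices. -/
theorem IsIrrChar.conj_inv {H : Type} [Group H] [Finite H] {χ : H → ℂ} (hχ : IsIrrChar H χ) :
    IsIrrChar H (fun h => starRingEnd ℂ (χ h⁻¹)) := by
  have := Fintype.ofFinite H
  obtain ⟨V, hV, rfl⟩ := hχ
  let b := Module.finBasis ℂ V
  let ρ : Representation ℂ H (Fin (Module.finrank ℂ V) → ℂ) :=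
    { toFun h := toLin' (LinearMap.toMatrix b b (V.ρ h⁻¹))ᴴ
      map_one' := by simp; rfl
      map_mul' g h := by
        rw [_root_.mul_inv_rev, map_mul, LinearMap.toMatrix_mul, conjTranspose_mul, toLin'_mul]
        rfl }
  have hρ (h : H) : (FDRep.of ρ).character h = starRingEnd ℂ (V.character h⁻¹) := by
    change LinearMap.trace ℂ _ (toLin' (LinearMap.toMatrix b b (V.ρ h⁻¹))ᴴ) = _
    rw [trace_toLin'_eq, trace_conjTranspose, FDRep.character, LinearMap.trace_eq_matrix_trace ℂ b]
    rfl
  refine ⟨FDRep.of ρ, ?_, funext fun h => (hρ h).symm⟩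
  rw [FDRep.simple_iff_char_is_norm_one] at hV ⊢
  simp_rw [hρ, ← map_mul, ← map_sum]
  have hinv := Equiv.sum_comp (Equiv.inv H) (fun h => V.character h * V.character h⁻¹)
  simp only [Equiv.inv_apply] at hinv
  rw [hinv, hV, map_natCast]

open CategoryTheory in
/-- A nonzero intertwining map out of a simple representation is injective. -/
theorem injective_of_simple {G W : Type} [Group G] (V : FDRep ℂ G) [Simple V]
    [AddCommGroup W] [Module ℂ W] [FiniteDimensional ℂ W] (σ : Representation ℂ G W)
    (f : Representation.IntertwiningMap V.ρ σ) (hf : f ≠ 0) : Function.Injective f := by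
  let F : (forget₂ (FDRep ℂ G) (Rep ℂ G)).obj V ⟶
    (forget₂ (FDRep ℂ G) (Rep ℂ G)).obj (FDRep.of σ) := Rep.ofHom f
  let F' : V ⟶ FDRep.of σ := FDRep.forget₂HomLinearEquiv _ _ F
  have hF : F' ≠ 0 := by
    intro h
    have : F = 0 := (LinearEquiv.map_eq_zero_iff _).mp h
    exact hf (congrArg Rep.Hom.hom this)
  have : Mono F' := mono_of_nonzero_from_simple hF
  have : Mono F := inferInstanceAs (Mono ((forget₂ (FDRep ℂ G) (Rep ℂ G)).map F'))
  exact (Rep.mono_iff_injective F).1 this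

theorem asAlgebraHom_ofModule' {H M : Type} [Group H] [AddCommGroup M] [Module ℂ M]
    [Module (MonoidAlgebra ℂ H) M] [IsScalarTower ℂ (MonoidAlgebra ℂ H) M]
    (a : MonoidAlgebra ℂ H) (m : M) :
    (Representation.ofModule' (k := ℂ) (G := H) M).asAlgebraHom a m = a • m := by
  rw [Representation.asAlgebraHom_def, Representation.ofModule', Equiv.apply_symm_apply]
  rfl

/-- A simple module over a complex group algebra is irreducible as a representation. -/
theorem isIrreducible_ofModule' {H M : Type} [Group H] [AddCommGroup M] [Module ℂ M]
    [Module (MonoidAlgebra ℂ H) M] [IsScalarTower ℂ (MonoidAlgebra ℂ H) M]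
    [IsSimpleModule (MonoidAlgebra ℂ H) M] :
    (Representation.ofModule' (k := ℂ) (G := H) M).IsIrreducible := by
  rw [Representation.irreducible_iff_isSimpleModule_asModule]
  let e : (Representation.ofModule' (k := ℂ) (G := H) M).asModule ≃ₗ[MonoidAlgebra ℂ H] M :=
    { (Representation.ofModule' (k := ℂ) (G := H) M).asModuleEquiv.toAddEquiv with
      map_smul' a m := by exact asAlgebraHom_ofModule' (M := M) a m }
  exact IsSimpleModule.congr e

/-- A nonzero element of a complex group algebra acts nontrivially on an irreducible
representation. -/
theorem exists_isIrreducible_asAlgebraHom_ne_zero {H : Type} [Group H] [Finite H]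
    (a : MonoidAlgebra ℂ H) (ha : a ≠ 0) :
    ∃ (V : Type) (_ : AddCommGroup V) (_ : Module ℂ V) (ρ : Representation ℂ H V),
      FiniteDimensional ℂ V ∧ ρ.IsIrreducible ∧ ρ.asAlgebraHom a ≠ 0 := by
  obtain ⟨T, hT, t, ht, hat⟩ : ∃ T : Submodule (MonoidAlgebra ℂ H) (MonoidAlgebra ℂ H),
      IsSimpleModule (MonoidAlgebra ℂ H) T ∧ ∃ t ∈ T, a * t ≠ 0 := by
    by_contra! h
    have h1 : (1 : MonoidAlgebra ℂ H) ∈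
        sSup {T : Submodule (MonoidAlgebra ℂ H) (MonoidAlgebra ℂ H) |
          IsSimpleModule (MonoidAlgebra ℂ H) T} := by
      rw [IsSemisimpleModule.sSup_simples_eq_top]; trivial
    rw [sSup_eq_iSup'] at h1
    refine ha ?_
    rw [← mul_one a]
    exact Submodule.iSup_induction _ (motive := fun x => a * x = 0) h1
      (fun T x hx => h T.1 T.2 x hx) (mul_zero a)
      fun x y hx hy => by rw [mul_add, hx, hy, add_zero]
  refine ⟨T, _, _, Representation.ofModule' T, ?_, isIrreducible_ofModule', fun h => hat ?_⟩
  · exact FiniteDimensional.of_injective (T.subtype.restrictScalars ℂ) T.injective_subtype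
  · have := congr($h ⟨t, ht⟩)
    rw [asAlgebraHom_ofModule'] at this
    exact congrArg Subtype.val this

section

open Representation

/-- The representation of `G` by left translation on the functions on `G ⧸ H`. -/
def cosetFunctionRep {G : Type} [Group G] (H : Subgroup G) : Representation ℂ G (G ⧸ H → ℂ) where
  toFun g := LinearMap.funLeft ℂ ℂ (g⁻¹ • ·)
  map_one' := by ext; simp [LinearMap.funLeft_apply]
  map_mul' g h := by ext; simp [LinearMap.funLeft_apply, mul_smul]

/-- The map `v ↦ (gH ↦ f (g⁻¹ v))` attached to an `H`-invariant functional `f`. -/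
def toCosetFunction {G V : Type} [Group G] [AddCommGroup V] [Module ℂ V] (H : Subgroup G)
    (ρ : Representation ℂ G V) (f : IntertwiningMap (ρ.comp H.subtype) (trivial ℂ H ℂ)) :
    IntertwiningMap ρ (cosetFunctionRep H) where
  toFun v x := Quotient.liftOn' x (fun g => f (ρ g⁻¹ v)) fun g h hgh => by
    have := f.isIntertwining _ _ (⟨g⁻¹ * h, QuotientGroup.leftRel_apply.1 hgh⟩ : H) (ρ h⁻¹ v)
    simpa [← Module.End.mul_apply, ← map_mul] using this
  map_add' v w := by ext x; induction x using Quotient.inductionOn'; simp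
  map_smul' c v := by ext x; induction x using Quotient.inductionOn'; simp
  isIntertwining' g := by
    ext v x
    induction x using Quotient.inductionOn' with
    | h y =>
      change f (ρ y⁻¹ (ρ g v)) = f (ρ (g⁻¹ * y)⁻¹ v)
      simp

/-- The multiplicity formula, with the complex conjugate written through the inverse. -/
theorem charInner_eq_finrank {H V W : Type} [Group H] [Finite H] [AddCommGroup V] [Module ℂ V]
    [FiniteDimensional ℂ V] [AddCommGroup W] [Module ℂ W] [FiniteDimensional ℂ W]
    (ρ : Representation ℂ H V) (σ : Representation ℂ H W) :
    charInner H σ.character (fun h => starRingEnd ℂ (ρ.character h⁻¹)) =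
      Module.finrank ℂ (IntertwiningMap ρ σ) := by
  have := Fintype.ofFinite H
  have := invertibleOfNonzero (NeZero.ne (Nat.card H : ℂ))
  rw [← card_inv_mul_sum_char_mul_char_eq_finrank, charInner, finsum_eq_sum_of_fintype]
  simp

theorem charInner_one_eq_finrank {H V : Type} [Group H] [Finite H] [AddCommGroup V] [Module ℂ V]
    [FiniteDimensional ℂ V] (ρ : Representation ℂ H V) :
    charInner H ρ.character (fun _ => 1) =
      Module.finrank ℂ (IntertwiningMap ρ (trivial ℂ H ℂ)) := by
  have := Fintype.ofFinite H
  have := invertibleOfNonzero (NeZero.ne (Nat.card H : ℂ))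
  have h1 (h : H) : (trivial ℂ H ℂ).character h = 1 := by
    simp [Representation.character, Representation.trivial]
  rw [← card_inv_mul_sum_char_mul_char_eq_finrank, charInner, finsum_eq_sum_of_fintype,
    ← Equiv.sum_comp (Equiv.inv H)]
  simp [h1]

theorem isIrrChar_one (H : Type) [Group H] [Finite H] : IsIrrChar H (fun _ => 1) := by
  have := Fintype.ofFinite H
  have h1 (h : H) : (FDRep.of (trivial ℂ H ℂ)).character h = 1 :=
    (LinearMap.trace_one ℂ ℂ).trans (by simp)
  refine ⟨FDRep.of (trivial ℂ H ℂ), ?_, funext fun h => (h1 h).symm⟩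
  rw [FDRep.simple_iff_char_is_norm_one]
  simp [h1]

theorem asAlgebraHom_intertwining {H V W : Type} [Group H] [AddCommGroup V] [Module ℂ V]
    [AddCommGroup W] [Module ℂ W] {ρ : Representation ℂ H V} {σ : Representation ℂ H W}
    (f : IntertwiningMap ρ σ) (a : MonoidAlgebra ℂ H) (v : V) :
    f (ρ.asAlgebraHom a v) = σ.asAlgebraHom a (f v) :=
  (IntertwiningMap.equivLinearMapAsModule ρ σ f).map_smul a v

/-- If `[G : H]² < |H|`, then some irreducible character of `H` is not linked to the trivial
character: it does not occur in the permutation character on `G ⧸ H`, as the group algebra of `H`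
does not act faithfully there. -/
theorem exists_not_linked_of_index_sq_lt {G : Type} [Group G] [Finite G] (H : Subgroup G)
    (hH : H.index ^ 2 < Nat.card H) :
    ∃ α β : ↥H → ℂ, IsIrrChar ↥H α ∧ IsIrrChar ↥H β ∧ ¬ Linked H α β := by
  let π : Representation ℂ H (G ⧸ H → ℂ) := (cosetFunctionRep H).comp H.subtype
  obtain ⟨a, haπ, ha⟩ : ∃ a, π.asAlgebraHom a = 0 ∧ a ≠ 0 := by
    have := Fintype.ofFinite (G ⧸ H)
    have := Fintype.ofFinite H
    have hlt : Module.finrank ℂ (Module.End ℂ (G ⧸ H → ℂ)) <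
        Module.finrank ℂ (MonoidAlgebra ℂ H) := by
      rw [Module.finrank_linearMap, Module.finrank_fintype_fun_eq_card,
        Fintype.card_eq_nat_card, ← Subgroup.index_eq_card]
      rwa [(MonoidAlgebra.coeffLinearEquiv ℂ).finrank_eq, Module.finrank_finsupp_self,
        Fintype.card_eq_nat_card, ← sq]
    obtain ⟨a, ha, h0⟩ := Submodule.exists_mem_ne_zero_of_ne_bot
      (LinearMap.ker_ne_bot_of_finrank_lt (f := π.asAlgebraHom.toLinearMap) hlt)
    exact ⟨a, ha, h0⟩
  obtain ⟨T, _, _, τ, _, hτ, haτ⟩ := exists_isIrreducible_asAlgebraHom_ne_zero a ha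
  refine ⟨fun _ => 1, _, isIrrChar_one H, (isIrrChar_of_isIrreducible τ).conj_inv, ?_⟩
  rintro ⟨_, ⟨V, hV, rfl⟩, h1, h2⟩
  let ρ : Representation ℂ H V := MonoidHom.comp V.ρ H.subtype
  change charInner H ρ.character _ ≠ 0 at h1 h2
  rw [charInner_one_eq_finrank, Nat.cast_ne_zero, ← Nat.pos_iff_ne_zero,
    Module.finrank_pos_iff_exists_ne_zero] at h1
  rw [charInner_eq_finrank, Nat.cast_ne_zero, ← Nat.pos_iff_ne_zero,
    Module.finrank_pos_iff_exists_ne_zero] at h2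
  obtain ⟨f, hf⟩ := h1
  obtain ⟨e, he⟩ := h2
  let F := toCosetFunction H V.ρ f
  have hF : Function.Injective F := by
    refine injective_of_simple V _ F fun h => hf ?_
    ext v
    have := congrFun (congr($h v)) (QuotientGroup.mk 1)
    change f (V.ρ 1⁻¹ v) = 0 at this
    simpa using this
  let F' : IntertwiningMap ρ π := ⟨F.toLinearMap, fun h => F.isIntertwining' h⟩
  have hinj : Function.Injective (F'.comp e) :=
    hF.comp ((IsIrreducible.injective_or_eq_zero e).resolve_right he)
  refine haτ (LinearMap.ext fun t => hinj ?_)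
  rw [asAlgebraHom_intertwining, haπ]
  simp

end

theorem two_pow_le_card_linearEquiv (n : ℕ) :
    2 ^ ((n - 1) * n) ≤ Nat.card ((Fin n → ZMod 2) ≃ₗ[ZMod 2] (Fin n → ZMod 2)) := by
  rw [← Nat.card_congr ((Matrix.GeneralLinearGroup.toLin (n := Fin n) (R := ZMod 2)).trans
    (LinearMap.GeneralLinearGroup.generalLinearEquiv _ _)).toEquiv, Matrix.card_GL_field, pow_mul]
  calc (2 ^ (n - 1)) ^ n = ∏ _i : Fin n, 2 ^ (n - 1) := by simp
    _ ≤ _ := Finset.prod_le_prod' fun i _ => by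
      obtain ⟨m, rfl⟩ : ∃ m, n = m + 1 := ⟨n - 1, by have := i.2; omega⟩
      have : 2 ^ (i : ℕ) ≤ 2 ^ m := Nat.pow_le_pow_right two_pos (by omega)
      simp only [ZMod.card, add_tsub_cancel_right, pow_succ]
      omega

/-- The stabilizer of a line in `𝔽₂ⁿ` has index at most `2ⁿ`. -/
theorem index_lineStabilizer_le (n : ℕ)
    (U : Submodule (ZMod 2) (Fin n → ZMod 2)) (hU : Module.finrank (ZMod 2) U = 1)
    (H : Subgroup ((Fin n → ZMod 2) ≃ₗ[ZMod 2] (Fin n → ZMod 2)))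
    (hH : ∀ g : (Fin n → ZMod 2) ≃ₗ[ZMod 2] (Fin n → ZMod 2),
      g ∈ H ↔ U.map (g : (Fin n → ZMod 2) →ₗ[ZMod 2] (Fin n → ZMod 2)) = U) :
    H.index ≤ 2 ^ n := by
  obtain ⟨u, -, hu⟩ := finrank_eq_one_iff'.1 hU
  have hspan : U = Submodule.span (ZMod 2) {(u : Fin n → ZMod 2)} := by
    refine le_antisymm (fun x hx => ?_) (by simp)
    obtain ⟨c, hc⟩ := hu ⟨x, hx⟩
    exact Submodule.mem_span_singleton.2 ⟨c, congrArg Subtype.val hc⟩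
  have hinj : Function.Injective (fun x : _ ⧸ H => x.out (u : Fin n → ZMod 2)) := by
    intro x y hxy
    rw [← x.out_eq', ← y.out_eq', QuotientGroup.eq, hH]
    have : (x.out⁻¹ * y.out) (u : Fin n → ZMod 2) = u := by
      change x.out⁻¹ (y.out u) = u
      rw [← show x.out (u : Fin n → ZMod 2) = y.out u from hxy]
      exact x.out.symm_apply_apply _
    rw [hspan, Submodule.map_span, Set.image_singleton]
    exact congrArg (fun w => Submodule.span (ZMod 2) {w}) this
  rw [Subgroup.index_eq_card]
  simpa using Nat.card_le_card_of_injective _ hinj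

/-- Let `n ≥ 5`, let `G = GLₙ(𝔽₂)` (realized as the group of linear
automorphisms of `𝔽₂ⁿ`), and let `H` be the stabilizer in `G` of a 1-dimensional subspace
`U` of `𝔽₂ⁿ`. Then some two irreducible complex characters of `H` are not linked over `G`
(equivalently `⟨α^G, β^G⟩ = 0`, so `d_G(H) ≥ 5`). -/
theorem parabolic_GLn2_not_linked (n : ℕ) (hn : 5 ≤ n)
    (U : Submodule (ZMod 2) (Fin n → ZMod 2)) (hU : Module.finrank (ZMod 2) U = 1)
    (H : Subgroup ((Fin n → ZMod 2) ≃ₗ[ZMod 2] (Fin n → ZMod 2)))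
    (hH : ∀ g : (Fin n → ZMod 2) ≃ₗ[ZMod 2] (Fin n → ZMod 2),
      g ∈ H ↔ U.map (g : (Fin n → ZMod 2) →ₗ[ZMod 2] (Fin n → ZMod 2)) = U) :
    ∃ α β : ↥H → ℂ, IsIrrChar ↥H α ∧ IsIrrChar ↥H β ∧ ¬ Linked H α β := by
  have : Finite ((Fin n → ZMod 2) ≃ₗ[ZMod 2] (Fin n → ZMod 2)) := DFunLike.finite _
  have hindex := index_lineStabilizer_le n U hU H hH
  refine exists_not_linked_of_index_sq_lt H (lt_of_mul_lt_mul_right ?_ H.index.zero_le)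
  rw [H.card_mul_index]
  calc H.index ^ 2 * H.index = H.index ^ 3 := (pow_succ _ _).symm
    _ ≤ (2 ^ n) ^ 3 := Nat.pow_le_pow_left hindex 3
    _ = 2 ^ (n * 3) := (pow_mul _ _ _).symm
    _ < 2 ^ ((n - 1) * n) := Nat.pow_lt_pow_right one_lt_two (by
      rw [mul_comm]
      exact Nat.mul_lt_mul_of_pos_right (by omega) (by omega))
    _ ≤ _ := two_pow_le_card_linearEquiv n
end
end

section
/- Let q ≥ 7 be a Mersenne prime (so q = 2^k − 1 for some k and q is prime), let G = PGL₂(q) be the quotient of GL₂(𝔽_q) by its center, and let H be a Sylow 2-subgroup of G; then H is dihedral of order 2(q+1). Let N be a cyclic subgroup of H of index 2 (necessarily of order q+1), and let β be the nontrivial linear character of H with kernel N. Then the trivial character 1_H of H and β are not linked over G: no irreducible complex character χ of G satisfies both ⟨χ|_H, 1_H⟩ ≠ 0 and ⟨χ|_H, β⟩ ≠ 0 (equivalently ⟨1_H^G, β^G⟩ = 0, and consequently d_G(H) = 5). -/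
noncomputable section

open CategoryTheory in
/-- An invariant subspace of a simple finite-dimensional representation is trivial. -/
theorem FDRep.eq_bot_or_eq_top_of_simple {k G : Type} [Field k] [Group G] (V : FDRep k G)
    [Simple V] (W : Submodule k V) (hW : ∀ g, ∀ w ∈ W, V.ρ g w ∈ W) : W = ⊥ ∨ W = ⊤ := by
  let S : Subrepresentation V.ρ := ⟨W, fun g w hw => hW g w hw⟩
  let ι : FDRep.of S.toRepresentation ⟶ V :=
    ⟨InducedCategory.homMk (ModuleCat.ofHom W.subtype), fun g => by ext x; rfl⟩
  have hinj : Function.Injective ι := Subtype.val_injective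
  have : Mono ι := ConcreteCategory.mono_of_injective ι hinj
  by_cases h : ι = 0
  · left
    rw [eq_bot_iff]
    intro w hw
    have h2 : ι.hom.hom.hom ⟨w, hw⟩ = 0 := by rw [h]; rfl
    exact h2
  · right
    have := isIso_of_mono_of_nonzero h
    rw [eq_top_iff]
    intro w _
    have h2 : ι.hom.hom.hom ((inv ι).hom.hom.hom w) = w := by
      have h3 := IsIso.inv_hom_id ι
      exact congrArg (fun f => f.hom.hom.hom w) h3
    rw [← h2]
    exact Subtype.property _

theorem charInner_eq_trace {G : Type} [Group G] (H : Subgroup G) [Fintype H]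
    (V : FDRep ℂ G) (φ : H → ℂ) :
    charInner H (resChar H V.character) φ =
      (Nat.card H : ℂ)⁻¹ *
        LinearMap.trace ℂ V (∑ h : H, (starRingEnd ℂ) (φ h) • V.ρ (h : G)) := by
  rw [charInner, finsum_eq_sum_of_fintype, map_sum]
  congr 1
  refine Finset.sum_congr rfl fun h _ => ?_
  rw [map_smul, smul_eq_mul, mul_comm]
  rfl

/-- If `H ∖ N` meets every conjugate of `H`, where `N` has index two in `H`, then the trivial
character of `H` is not linked to the linear character with kernel `N`. -/
theorem not_linked_of_forall_conj_mem {G : Type} [Group G] [Finite G] (H : Subgroup G)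
    (N : Subgroup H) (hNi : N.index = 2) (β : H → ℂ)
    (hβ : ∀ h, (h ∈ N → β h = 1) ∧ (h ∉ N → β h = -1))
    (hconj : ∀ g : G, ∃ x : H, x ∉ N ∧ g⁻¹ * x * g ∈ H) :
    ¬ Linked H (fun _ => (1 : ℂ)) β := by
  have := Fintype.ofFinite H
  rintro ⟨χ, ⟨V, hV, rfl⟩, h₁, h₂⟩
  rw [charInner_eq_trace] at h₁ h₂
  set E : V →ₗ[ℂ] V := ∑ h : H, (starRingEnd ℂ) 1 • V.ρ (h : G) with hE
  set F : V →ₗ[ℂ] V := ∑ h : H, (starRingEnd ℂ) (β h) • V.ρ (h : G) with hF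
  have hEy (y : G) (hy : y ∈ H) : V.ρ y * E = E := by
    rw [hE, Finset.mul_sum]
    refine Fintype.sum_equiv (Equiv.mulLeft (⟨y, hy⟩ : H)) _ _ fun h => ?_
    rw [mul_smul_comm, ← map_mul]
    rfl
  have hβx (x h : H) (hx : x ∉ N) : β (h * x) = -β h := by
    have := Subgroup.mul_mem_iff_of_index_two hNi (a := h) (b := x)
    by_cases hh : h ∈ N
    · rw [(hβ h).1 hh, (hβ _).2 (by tauto)]
    · rw [(hβ h).2 hh, (hβ _).1 (by tauto), neg_neg]
  have hFx (x : H) (hx : x ∉ N) : F * V.ρ (x : G) = -F := by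
    rw [hF, Finset.sum_mul, ← Finset.sum_neg_distrib]
    refine Fintype.sum_equiv (Equiv.mulRight x) _ _ fun h => ?_
    rw [smul_mul_assoc, ← map_mul, Equiv.coe_mulRight, hβx x h hx, map_neg, neg_smul, neg_neg]
    rfl
  have hFE (g : G) : F * V.ρ g * E = 0 := by
    obtain ⟨x, hx, hxg⟩ := hconj g
    have hg : V.ρ g * V.ρ (g⁻¹ * x * g) = V.ρ (x : G) * V.ρ g := by
      rw [← map_mul, ← map_mul, mul_assoc g⁻¹, mul_inv_cancel_left]
    have h : F * V.ρ g * E = -(F * V.ρ g * E) := calc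
      F * V.ρ g * E = F * V.ρ g * (V.ρ (g⁻¹ * x * g) * E) := by rw [hEy _ hxg]
      _ = F * V.ρ (x : G) * V.ρ g * E := by
        rw [← mul_assoc, mul_assoc F, hg, ← mul_assoc]
      _ = -(F * V.ρ g * E) := by rw [hFx x hx, neg_mul, neg_mul]
    rwa [eq_neg_iff_add_eq_zero, ← two_smul ℂ, smul_eq_zero_iff_right two_ne_zero] at h
  let W : Submodule ℂ V := ⨅ g : G, LinearMap.ker (F * V.ρ g)
  have hW (w : V) : w ∈ W ↔ ∀ g, (F * V.ρ g) w = 0 := by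
    simp only [W, Submodule.mem_iInf, LinearMap.mem_ker]
  rcases V.eq_bot_or_eq_top_of_simple W fun g w hw => (hW _).2 fun g' => by
    have := (hW w).1 hw (g' * g)
    rwa [map_mul] at this with h | h
  · apply h₁
    have : E = 0 := by
      ext w
      have : E w ∈ W := (hW _).2 fun g => LinearMap.congr_fun (hFE g) w
      rw [h] at this
      exact this
    rw [this, map_zero, mul_zero]
  · apply h₂
    have : F = 0 := by
      ext w
      have := (hW w).1 (h ▸ Submodule.mem_top) 1
      rwa [map_one, mul_one] at this
    rw [this, map_zero, mul_zero]

namespace Matrix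

variable {F : Type*} [Field F]

/-- The centralizer and anticentralizer of a matrix whose square is a nonsquare scalar contain no
nonzero singular matrix. -/
theorem isUnit_det_of_mul_eq_or {v M : Matrix (Fin 2) (Fin 2) F} {d : F} (hd : ¬ IsSquare d)
    (hv : v * v = d • 1) (hM : M * v = v * M ∨ M * v = -(v * M)) (hM0 : M ≠ 0) :
    IsUnit M.det := by
  rw [isUnit_iff_ne_zero]
  intro hdet
  obtain ⟨u, hu, hMu⟩ := Matrix.exists_mulVec_eq_zero_iff.2 hdet
  have hMvu : M *ᵥ (v *ᵥ u) = 0 := by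
    rw [mulVec_mulVec]
    rcases hM with h | h <;> rw [h] <;> simp [neg_mulVec, ← mulVec_mulVec, hMu]
  let P : Matrix (Fin 2) (Fin 2) F := (of ![u, v *ᵥ u])ᵀ
  have hMP : M * P = 0 := by
    ext i j
    fin_cases j
    · exact congrFun hMu i
    · exact congrFun hMvu i
  have hP : P.det ≠ 0 := by
    intro hP
    obtain ⟨c, hc, hPc⟩ := Matrix.exists_mulVec_eq_zero_iff.2 hP
    have key : c 0 • u + c 1 • (v *ᵥ u) = 0 := by
      ext i
      have := congrFun hPc i
      rw [mulVec, dotProduct, Fin.sum_univ_two] at this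
      change u i * c 0 + (v *ᵥ u) i * c 1 = 0 at this
      change c 0 * u i + c 1 * (v *ᵥ u) i = 0
      linear_combination this
    have hc1 : c 1 ≠ 0 := by
      intro h1
      rw [h1, zero_smul, add_zero, smul_eq_zero] at key
      refine hc (funext fun i => ?_)
      fin_cases i
      · exact key.resolve_right hu
      · exact h1
    have heig : v *ᵥ u = (-(c 1)⁻¹ * c 0) • u := by
      have : c 1 • (v *ᵥ u) = -(c 0 • u) := eq_neg_of_add_eq_zero_right key
      rw [← inv_smul_smul₀ hc1 (v *ᵥ u), this, smul_neg, smul_smul, neg_mul, neg_smul]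
    have h2 : d • u = ((-(c 1)⁻¹ * c 0) * (-(c 1)⁻¹ * c 0)) • u := by
      rw [mul_smul, ← heig, ← mulVec_smul, ← heig, mulVec_mulVec, hv, smul_mulVec, one_mulVec]
    exact hd ⟨_, smul_left_injective F hu h2⟩
  apply hM0
  have := P.mul_nonsing_inv (isUnit_iff_ne_zero.2 hP)
  rw [← mul_one M, ← this, ← mul_assoc, hMP, zero_mul]

theorem mul_self_eq_smul_one_of_trace_eq_zero {v : Matrix (Fin 2) (Fin 2) F}
    (hv : v.trace = 0) : v * v = (-v.det) • 1 := by
  rw [trace_fin_two] at hv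
  ext i j
  fin_cases i <;> fin_cases j <;> simp [mul_apply, Fin.sum_univ_two, det_fin_two]
  · linear_combination v 0 0 * hv
  · linear_combination v 0 1 * hv
  · linear_combination v 1 0 * hv
  · linear_combination v 1 1 * hv

theorem eq_or_eq_neg_of_commute {v w : Matrix (Fin 2) (Fin 2) F} {d : F} (hd : ¬ IsSquare d)
    (hv : v * v = d • 1) (hw : w * w = d • 1) (h : Commute w v) : w = v ∨ w = -v := by
  by_cases h0 : w - v = 0
  · exact .inl (sub_eq_zero.1 h0)
  · right
    have hunit := isUnit_det_of_mul_eq_or hd hv (M := w - v)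
      (.inl (h.sub_left (Commute.refl v)).eq) h0
    have hz : (w - v) * (w + v) = 0 := by
      rw [sub_mul, mul_add, mul_add, hw, hv, h.eq]; abel
    have : w + v = 0 := by
      rw [← one_mul (w + v), ← nonsing_inv_mul _ hunit, mul_assoc, hz, mul_zero]
    exact eq_neg_of_add_eq_zero_left this

theorem exists_eq_smul_one_add_smul_of_commute {v B : Matrix (Fin 2) (Fin 2) F} {d : F}
    (hd : ¬ IsSquare d) (hv : v * v = d • 1) (h : Commute B v) :
    ∃ a b : F, B = a • 1 + b • v := by
  have hc : v 1 0 ≠ 0 := by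
    intro hc
    refine hd ⟨v 1 1, ?_⟩
    have := congrFun (congrFun hv 1) 1
    simp [mul_apply, Fin.sum_univ_two, hc] at this
    exact this.symm
  refine ⟨B 0 0 - B 1 0 / v 1 0 * v 0 0, B 1 0 / v 1 0, ?_⟩
  rw [← sub_eq_zero]
  by_contra hne
  have hcomm : Commute (B - ((B 0 0 - B 1 0 / v 1 0 * v 0 0) • 1 + (B 1 0 / v 1 0) • v)) v :=
    h.sub_left (((Commute.one_left v).smul_left _).add_left ((Commute.refl v).smul_left _))
  refine (isUnit_det_of_mul_eq_or hd hv (.inl hcomm.eq) hne).ne_zero ?_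
  rw [det_fin_two]
  simp [hc]

theorem exists_mul_self_eq_smul_one_of_anticommute {v B : Matrix (Fin 2) (Fin 2) F} {d : F}
    (h2 : (2 : F) ≠ 0) (hd : ¬ IsSquare d) (hv : v * v = d • 1) (hB : B ≠ 0)
    (h : B * v = -(v * B)) : ∃ a : F, B * B = a • 1 := by
  have hBB : Commute (B * B) v := by
    rw [Commute, SemiconjBy, mul_assoc, h, mul_neg, ← mul_assoc, h, neg_mul, neg_neg, mul_assoc]
  obtain ⟨a, b, hab⟩ := exists_eq_smul_one_add_smul_of_commute hd hv hBB
  refine ⟨a, ?_⟩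
  have hBu := isUnit_det_of_mul_eq_or hd hv (.inr h) hB
  have hcomm : B * (B * B) = (B * B) * B := (mul_assoc _ _ _).symm
  rw [hab, mul_add, add_mul, mul_smul_comm, smul_mul_assoc, mul_one, one_mul, add_right_inj,
    mul_smul_comm, smul_mul_assoc, h, smul_neg, neg_eq_iff_add_eq_zero, ← two_smul F,
    smul_eq_zero_iff_right h2, ← smul_mul_assoc] at hcomm
  have : b • v = 0 := by
    rw [← mul_one (b • v), ← mul_nonsing_inv _ hBu, ← mul_assoc, hcomm, zero_mul]
  rw [hab, this, add_zero]

theorem pow_card_smul_one_add {q : ℕ} [Fact q.Prime] (hq : Odd q)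
    {v : Matrix (Fin 2) (Fin 2) (ZMod q)} {d : ZMod q} (hv : v * v = d • 1) (a b : ZMod q) :
    (a • 1 + b • v) ^ q = a • 1 + (b * d ^ (q / 2)) • v := by
  have hvq : v ^ q = d ^ (q / 2) • v := by
    have h (n : ℕ) (hn : Odd n) : v ^ n = d ^ (n / 2) • v := by
      conv_lhs => rw [← Nat.two_mul_div_two_add_one_of_odd hn]
      rw [pow_succ, pow_mul, sq, hv, smul_pow, one_pow, smul_mul_assoc, one_mul]
    exact h q hq
  rw [add_pow_char_of_commute _ (((Commute.one_left v).smul_left a).smul_right b), smul_pow,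
    smul_pow, hvq, ZMod.pow_card, ZMod.pow_card, one_pow, smul_smul]

end Matrix

namespace Matrix.GeneralLinearGroup

/-- The invertible matrices that commute or anticommute with `v`. -/
def commuteOrAnticommute {F : Type*} [Field F] (v : Matrix (Fin 2) (Fin 2) F) :
    Subgroup (GL (Fin 2) F) where
  carrier := {B | (B : Matrix (Fin 2) (Fin 2) F) * v = v * B ∨
    (B : Matrix (Fin 2) (Fin 2) F) * v = -(v * B)}
  one_mem' := .inl (by simp)
  mul_mem' := by
    rintro A B (hA | hA) (hB | hB) <;>
      simp [mul_assoc, hB] <;>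
      simp [← mul_assoc, hA]
  inv_mem' := by
    have key (B : GL (Fin 2) F) (w : Matrix (Fin 2) (Fin 2) F)
        (h : (B : Matrix (Fin 2) (Fin 2) F) * v = w * B) :
        ((B⁻¹ : GL (Fin 2) F) : Matrix (Fin 2) (Fin 2) F) * w = v * (B⁻¹ : GL (Fin 2) F) := by
      rw [Units.inv_mul_eq_iff_eq_mul, ← mul_assoc, h, mul_assoc, Units.mul_inv, mul_one]
    rintro B (hB | hB)
    · exact .inl (key B v hB)
    · right
      have := key B (-v) (by rw [hB, neg_mul])
      rw [mul_neg] at this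
      exact neg_eq_iff_eq_neg.1 this

theorem mem_commuteOrAnticommute {F : Type*} [Field F] {v : Matrix (Fin 2) (Fin 2) F}
    {B : GL (Fin 2) F} : B ∈ commuteOrAnticommute v ↔
      (B : Matrix (Fin 2) (Fin 2) F) * v = v * B ∨
      (B : Matrix (Fin 2) (Fin 2) F) * v = -(v * B) := Iff.rfl

theorem mk_eq_one_of_eq_smul_one {F : Type*} [Field F] {B : GL (Fin 2) F} {a : F}
    (h : (B : Matrix (Fin 2) (Fin 2) F) = a • 1) :
    (B : GL (Fin 2) F ⧸ Subgroup.center (GL (Fin 2) F)) = 1 := by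
  rw [QuotientGroup.eq_one_iff, Subgroup.mem_center_iff]
  intro g
  ext1
  simp [h]

/-- If `B` is congruent to a power of `A` modulo scalars, then `B` commutes with `A`. -/
theorem commute_of_mk_eq_zpow {F : Type*} [Field F] {A B : GL (Fin 2) F} {j : ℤ}
    (h : (B : GL (Fin 2) F ⧸ Subgroup.center (GL (Fin 2) F)) = (A : GL (Fin 2) F ⧸ _) ^ j) :
    Commute B A := by
  rw [← QuotientGroup.mk_zpow, eq_comm, QuotientGroup.eq, Subgroup.mem_center_iff] at h
  have h' : Commute ((A ^ j)⁻¹ * B) A := (h A).symm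
  have := ((Commute.refl A).zpow_left j).mul_left h'
  rwa [mul_inv_cancel_left] at this

variable {q : ℕ} [Fact q.Prime]

/-- For `q ≡ 3 mod 4`, an element of `PGL₂(q)` whose order is divisible by four lies in a nonsplit
torus. -/
theorem not_isSquare_of_four_dvd_orderOf (hq : q % 4 = 3) {A : GL (Fin 2) (ZMod q)}
    {v : Matrix (Fin 2) (Fin 2) (ZMod q)} {t d : ZMod q}
    (hA : (A : Matrix (Fin 2) (Fin 2) (ZMod q)) = t • 1 + v) (hv : v * v = d • 1)
    (h4 : 4 ∣ orderOf
      (A : GL (Fin 2) (ZMod q) ⧸ Subgroup.center (GL (Fin 2) (ZMod q)))) :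
    ¬ IsSquare d := by
  rintro ⟨s, rfl⟩
  have hodd : Odd q := Nat.odd_iff.2 (by lia)
  have hpow := pow_card_smul_one_add hodd hv t 1
  rw [one_smul, ← hA, one_mul, ← Units.val_pow_eq_pow_val] at hpow
  have hdvd : ¬ 4 ∣ q ∧ ¬ 4 ∣ q - 1 := by lia
  by_cases hs : s = 0
  · have h0 : (s * s) ^ (q / 2) = 0 := by
      rw [hs, zero_mul, zero_pow]; lia
    rw [h0, zero_smul, add_zero] at hpow
    exact hdvd.1 (h4.trans (orderOf_dvd_of_pow_eq_one (mk_eq_one_of_eq_smul_one hpow)))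
  · have h1 : (s * s) ^ (q / 2) = 1 := by
      rw [← sq, ← pow_mul, ← ZMod.pow_card_sub_one_eq_one hs]
      congr 1
      lia
    rw [h1, one_smul, ← hA] at hpow
    have hAq : A ^ (q - 1) = 1 := by
      have : A ^ q = A := Units.ext hpow
      rwa [← pow_sub_one_mul (Fact.out : q.Prime).ne_zero, mul_eq_right] at this
    refine hdvd.2 (h4.trans (orderOf_dvd_of_pow_eq_one ?_))
    rw [← QuotientGroup.mk_pow, hAq, QuotientGroup.mk_one]

theorem two_ne_zero_of_odd (hodd : Odd q) : (2 : ZMod q) ≠ 0 := by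
  intro h
  have := (ZMod.natCast_eq_zero_iff 2 q).1 (by exact_mod_cast h)
  have := (Nat.prime_dvd_prime_iff_eq Fact.out Nat.prime_two).1 this
  subst this
  exact absurd hodd (by decide)

theorem isPGroup_map_commuteOrAnticommute {k : ℕ} (hk : q + 1 = 2 ^ k) (hodd : Odd q)
    {v : Matrix (Fin 2) (Fin 2) (ZMod q)} {d : ZMod q} (hd : ¬ IsSquare d)
    (hv : v * v = d • 1) :
    IsPGroup 2 ((commuteOrAnticommute v).map
      (QuotientGroup.mk' (Subgroup.center (GL (Fin 2) (ZMod q))))) := by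
  rintro ⟨_, B, hB, rfl⟩
  rcases mem_commuteOrAnticommute.1 hB with h | h
  · refine ⟨k, Subtype.ext ?_⟩
    obtain ⟨a, b, hab⟩ := exists_eq_smul_one_add_smul_of_commute hd hv h
    have hd0 : d ≠ 0 := by
      rintro rfl
      exact hd (IsSquare.zero)
    have hdq : d ^ (q / 2) = -1 :=
      (ZMod.pow_div_two_eq_neg_one_or_one q hd0).resolve_left fun h =>
        hd ((ZMod.euler_criterion q hd0).2 h)
    have hpow := pow_card_smul_one_add hodd hv a b
    rw [← hab, hdq, mul_neg_one] at hpow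
    refine mk_eq_one_of_eq_smul_one (B := B ^ 2 ^ k) (a := a * a - b * b * d) ?_
    rw [← hk, Units.val_pow_eq_pow_val, pow_succ, hpow, hab]
    simp only [add_mul, mul_add, smul_mul_smul_comm, one_mul, mul_one, hv, neg_mul, neg_smul,
      smul_smul, sub_smul, mul_comm b a]
    abel
  · refine ⟨1, Subtype.ext ?_⟩
    have hB0 : (B : Matrix (Fin 2) (Fin 2) (ZMod q)) ≠ 0 := B.ne_zero
    obtain ⟨a, ha⟩ :=
      exists_mul_self_eq_smul_one_of_anticommute (two_ne_zero_of_odd hodd) hd hv hB0 h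
    refine mk_eq_one_of_eq_smul_one (B := B ^ 2 ^ 1) (a := a) ?_
    rw [pow_one, Units.val_pow_eq_pow_val, sq, ha]

theorem eight_dvd_card_sylow (hq8 : 8 ∣ q + 1)
    (H : Sylow 2 (GL (Fin 2) (ZMod q) ⧸ Subgroup.center (GL (Fin 2) (ZMod q)))) :
    8 ∣ Nat.card H := by
  refine H.pow_dvd_card_of_pow_dvd_card (n := 3) ?_
  obtain ⟨m, hm⟩ : Nat.card (Subgroup.center (GL (Fin 2) (ZMod q))) ∣ q - 1 := by
    have h : Nat.card (ZMod q)ˣ = q - 1 := by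
      rw [Nat.card_eq_fintype_card, ZMod.card_units]
    rw [center_eq_range_scalar, ← h]
    exact Subgroup.card_range_dvd _
  have hcard := Subgroup.card_eq_card_quotient_mul_card_subgroup
    (Subgroup.center (GL (Fin 2) (ZMod q)))
  have hGL : Nat.card (GL (Fin 2) (ZMod q)) = (q - 1) * ((q + 1) * (q * (q - 1))) := by
    rw [card_GL_field, Fin.prod_univ_two, ZMod.card]
    obtain ⟨p, rfl⟩ : ∃ p, q = p + 1 := ⟨q - 1, by have := (Fact.out : q.Prime).one_le; lia⟩
    simp only [Fin.val_zero, Fin.val_one, pow_zero, pow_one, Nat.add_sub_cancel]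
    have e1 : (p + 1) ^ 2 - 1 = p * (p + 2) := by
      rw [Nat.sub_eq_iff_eq_add (Nat.one_le_pow _ _ (by lia))]; ring
    have e2 : (p + 1) ^ 2 - (p + 1) = (p + 1) * p := by
      rw [Nat.sub_eq_iff_eq_add (by nlinarith)]; ring
    rw [e1, e2]; ring
  rw [hGL, hm, mul_assoc, mul_comm] at hcard
  have := Nat.eq_of_mul_eq_mul_right Nat.card_pos hcard
  rw [← this]
  exact Dvd.dvd.mul_left (hq8.mul_right _) _

theorem conj_mul_self_eq_smul_one {F : Type*} [Field F] {v : Matrix (Fin 2) (Fin 2) F} {d : F}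
    (hv : v * v = d • 1) (B : GL (Fin 2) F) :
    (B * v * (B⁻¹ : GL (Fin 2) F) : Matrix (Fin 2) (Fin 2) F) *
      (B * v * (B⁻¹ : GL (Fin 2) F)) = d • 1 := by
  simp only [mul_assoc, Units.inv_mul_cancel_left]
  rw [← mul_assoc v v, hv, smul_mul_assoc, one_mul, mul_smul_comm, Units.mul_inv]

theorem mem_commuteOrAnticommute_of_commute_conj {F : Type*} [Field F]
    {v : Matrix (Fin 2) (Fin 2) F} {d : F} (hd : ¬ IsSquare d) (hv : v * v = d • 1)
    {B : GL (Fin 2) F} (h : Commute (B * v * (B⁻¹ : GL (Fin 2) F)) v) :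
    B ∈ commuteOrAnticommute v := by
  have hB : B * v * (B⁻¹ : GL (Fin 2) F) * B = (B : Matrix (Fin 2) (Fin 2) F) * v := by
    rw [mul_assoc, Units.inv_mul, mul_one]
  rw [mem_commuteOrAnticommute, ← hB]
  rcases eq_or_eq_neg_of_commute hd hv (conj_mul_self_eq_smul_one hv B) h with h | h
  · exact .inl (by rw [h])
  · exact .inr (by rw [h, neg_mul])

/-- Let `v` be a matrix whose square is a nonsquare scalar and `w` a conjugate of `v`. Either
`w = ± v`, or the commutator of `v` and `w` is invertible and anticommutes with both. -/
theorem mem_or_exists_anticommute {F : Type*} [Field F] {v : Matrix (Fin 2) (Fin 2) F} {d : F}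
    (hd : ¬ IsSquare d) (hv : v * v = d • 1) (B : GL (Fin 2) F) :
    B ∈ commuteOrAnticommute v ∨ ∃ X : GL (Fin 2) F,
      (X : Matrix (Fin 2) (Fin 2) F) * v = -(v * X) ∧ B⁻¹ * X * B ∈ commuteOrAnticommute v := by
  set w : Matrix (Fin 2) (Fin 2) F := B * v * (B⁻¹ : GL (Fin 2) F) with hw
  have hwB : w * B = B * v := by rw [hw, mul_assoc, Units.inv_mul, mul_one]
  have hBw : ((B⁻¹ : GL (Fin 2) F) : Matrix (Fin 2) (Fin 2) F) * w =
      v * (B⁻¹ : GL (Fin 2) F) := by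
    rw [hw, mul_assoc, Units.inv_mul_cancel_left]
  have hww : w * w = d • 1 := conj_mul_self_eq_smul_one hv B
  by_cases h : v * w - w * v = 0
  · exact .inl (mem_commuteOrAnticommute_of_commute_conj hd hv (sub_eq_zero.1 h).symm)
  · right
    have hXv : (v * w - w * v) * v = -(v * (v * w - w * v)) := by
      rw [sub_mul, mul_sub, mul_assoc w, hv, ← mul_assoc v v, hv]
      simp [mul_assoc]
    have hXw : (v * w - w * v) * w = -(w * (v * w - w * v)) := by
      rw [sub_mul, mul_sub, mul_assoc v, hww, ← mul_assoc w w, hww]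
      simp [mul_assoc]
    obtain ⟨X, hX⟩ := (Matrix.isUnit_iff_isUnit_det _).2
      (isUnit_det_of_mul_eq_or hd hv (.inr hXv) h)
    rw [← hX] at hXv hXw
    refine ⟨X, hXv, .inr ?_⟩
    simp only [Units.val_mul]
    rw [mul_assoc _ _ v, ← hwB, mul_assoc _ _ (w * _), ← mul_assoc _ w, hXw, neg_mul, mul_neg,
      mul_assoc w, ← mul_assoc _ w, hBw]
    simp only [mul_assoc]

end Matrix.GeneralLinearGroup

/-- Let `q ≥ 7` be a Mersenne prime, `G = PGL₂(q) = GL₂(𝔽_q)/Z`, and let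
`H` be a Sylow 2-subgroup of `G` (dihedral of order `2(q+1)`). Let `N ≤ H` be a cyclic
subgroup of index 2 and `β` the nontrivial linear character of `H` with kernel `N`. Then
the trivial character of `H` and `β` are not linked over `G` (so `d_G(H) = 5`). -/
theorem pgl2_sylow_not_linked (q : ℕ) (hq : q.Prime) (hq7 : 7 ≤ q)
    (k : ℕ) (hk : q = 2 ^ k - 1)
    (H : Sylow 2 (Matrix.GeneralLinearGroup (Fin 2) (ZMod q) ⧸
      Subgroup.center (Matrix.GeneralLinearGroup (Fin 2) (ZMod q))))
    (N : Subgroup ↥(H : Subgroup (Matrix.GeneralLinearGroup (Fin 2) (ZMod q) ⧸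
      Subgroup.center (Matrix.GeneralLinearGroup (Fin 2) (ZMod q)))))
    (hN : IsCyclic ↥N) (hNi : N.index = 2)
    (β : ↥(H : Subgroup (Matrix.GeneralLinearGroup (Fin 2) (ZMod q) ⧸
      Subgroup.center (Matrix.GeneralLinearGroup (Fin 2) (ZMod q)))) → ℂ)
    (hβ : ∀ h, (h ∈ N → β h = 1) ∧ (h ∉ N → β h = -1)) :
    ¬ Linked (H : Subgroup (Matrix.GeneralLinearGroup (Fin 2) (ZMod q) ⧸
      Subgroup.center (Matrix.GeneralLinearGroup (Fin 2) (ZMod q))))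
      (fun _ => (1 : ℂ)) β := by
  have : Fact q.Prime := ⟨hq⟩
  have hqk : q + 1 = 2 ^ k := by lia
  have hk3 : 3 ≤ k := by
    by_contra! h
    have : 2 ^ k ≤ 2 ^ 2 := Nat.pow_le_pow_right two_pos (by lia)
    lia
  have hq8 : 8 ∣ q + 1 := by
    rw [hqk]
    exact pow_dvd_pow 2 hk3
  have hodd : Odd q := Nat.odd_iff.2 (by lia)
  have h2 := Matrix.GeneralLinearGroup.two_ne_zero_of_odd hodd
  have hN4 : 4 ∣ Nat.card N := by
    have h8 := Matrix.GeneralLinearGroup.eight_dvd_card_sylow hq8 H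
    have := N.card_mul_index
    rw [hNi] at this
    lia
  obtain ⟨n, hn⟩ := hN.exists_generator
  obtain ⟨A, hA⟩ := QuotientGroup.mk_surjective (n : H).1
  have hNA (x : H) (hx : x ∈ N) (B : Matrix.GeneralLinearGroup (Fin 2) (ZMod q))
      (hB : (B : _ ⧸ Subgroup.center (Matrix.GeneralLinearGroup (Fin 2) (ZMod q))) = x) :
      Commute B A := by
    obtain ⟨j, hj⟩ := Subgroup.mem_zpowers_iff.1 (hn ⟨x, hx⟩)
    refine Matrix.GeneralLinearGroup.commute_of_mk_eq_zpow (j := j) ?_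
    rw [hB, hA, ← Subgroup.coe_zpow, ← Subgroup.coe_zpow, hj]
  obtain ⟨t, v, hAv, hv0⟩ : ∃ (t : ZMod q) (v : Matrix (Fin 2) (Fin 2) (ZMod q)),
      (A : Matrix (Fin 2) (Fin 2) (ZMod q)) = t • 1 + v ∧ v.trace = 0 := by
    refine ⟨(A : Matrix (Fin 2) (Fin 2) (ZMod q)).trace / 2, _, (add_sub_cancel _ _).symm, ?_⟩
    rw [Matrix.trace_sub, Matrix.trace_smul, Matrix.trace_one, Fintype.card_fin, smul_eq_mul,
      Nat.cast_ofNat, div_mul_cancel₀ _ h2, sub_self]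
  have hv := Matrix.mul_self_eq_smul_one_of_trace_eq_zero hv0
  have hvA : v = (A : Matrix (Fin 2) (Fin 2) (ZMod q)) - t • 1 := by
    rw [hAv, add_sub_cancel_left]
  have hd : ¬ IsSquare (-v.det) := by
    refine Matrix.GeneralLinearGroup.not_isSquare_of_four_dvd_orderOf (by lia) hAv hv ?_
    rwa [hA, Subgroup.orderOf_coe, Subgroup.orderOf_coe, orderOf_eq_card_of_forall_mem_zpowers hn]
  have hcomm {B : Matrix.GeneralLinearGroup (Fin 2) (ZMod q)} (hB : Commute B A) :
      Commute (B : Matrix (Fin 2) (Fin 2) (ZMod q)) v := by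
    rw [hvA]
    exact (hB.map (Units.coeHom _)).sub_right ((Commute.one_right _).smul_right t)
  have hNn : N.Normal := Subgroup.normal_of_index_eq_two hNi
  have hle : (H : Subgroup _) ≤ (Matrix.GeneralLinearGroup.commuteOrAnticommute v).map
      (QuotientGroup.mk' (Subgroup.center (Matrix.GeneralLinearGroup (Fin 2) (ZMod q)))) := by
    intro h hh
    obtain ⟨B, rfl⟩ := QuotientGroup.mk_surjective h
    refine ⟨B, ?_, rfl⟩
    have hBA := hNA _ (hNn.conj_mem n n.2 ⟨_, hh⟩) (B * A * B⁻¹) (by simp [hA])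
    apply Matrix.GeneralLinearGroup.mem_commuteOrAnticommute_of_commute_conj hd hv
    have hBv : (B : Matrix (Fin 2) (Fin 2) (ZMod q)) * v *
        (B⁻¹ : Matrix.GeneralLinearGroup (Fin 2) (ZMod q)) =
        (B * A * B⁻¹ : Matrix.GeneralLinearGroup (Fin 2) (ZMod q)) - t • 1 := by
      rw [hvA, mul_sub, sub_mul, mul_smul_comm, smul_mul_assoc, mul_one, Units.mul_inv,
        Units.val_mul, Units.val_mul]
    rw [hBv]
    exact (hcomm hBA).sub_left ((Commute.one_left v).smul_left t)
  have hHK := H.is_maximal'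
    (Matrix.GeneralLinearGroup.isPGroup_map_commuteOrAnticommute hqk hodd hd hv) hle
  refine not_linked_of_forall_conj_mem _ N hNi β hβ fun g => ?_
  obtain ⟨B, rfl⟩ := QuotientGroup.mk_surjective g
  have hmem {C : Matrix.GeneralLinearGroup (Fin 2) (ZMod q)}
      (hC : C ∈ Matrix.GeneralLinearGroup.commuteOrAnticommute v) :
      (C : _ ⧸ Subgroup.center (Matrix.GeneralLinearGroup (Fin 2) (ZMod q))) ∈
        (H : Subgroup _) := by
    rw [← hHK]
    exact ⟨C, hC, rfl⟩
  rcases Matrix.GeneralLinearGroup.mem_or_exists_anticommute hd hv B with h | ⟨X, hX, hXB⟩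
  · obtain ⟨x, hx⟩ : ∃ x, x ∉ N := by
      by_contra! hall
      rw [(Subgroup.eq_top_iff' N).2 hall, Subgroup.index_top] at hNi
      lia
    exact ⟨x, hx, mul_mem (mul_mem (inv_mem (hmem h)) x.2) (hmem h)⟩
  · refine ⟨⟨_, hmem (.inr hX)⟩, fun hXN => ?_, hmem hXB⟩
    have hXv := (hcomm (hNA _ hXN X rfl)).eq
    rw [hX, neg_eq_iff_add_eq_zero, ← two_smul (ZMod q), smul_eq_zero_iff_right h2,
      Units.mul_left_eq_zero] at hXv
    refine hd ?_
    rw [hXv, Matrix.det_zero, neg_zero]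
    exact IsSquare.zero
end
end

section
/- Let G = S₆ be the symmetric group on 6 letters and let H be a subgroup of G that acts transitively on the 6 letters and is abstractly isomorphic to S₅ (such H exists, acts primitively, and is isomorphic to PGL₂(5)). Then the Külshammer graph K(G,H) has diameter exactly 4: any two irreducible complex characters of H are joined by a path of length at most 4 in K(G,H), and there exist two irreducible complex characters of H joined by no path of length at most 3. (Equivalently, d_G(H) = 9; this is the unique case of maximal depth among primitive subgroups of almost simple groups with alternating socle.) -/
noncomputable section

open scoped ComplexOrder

section CharacterTheory

variable {G : Type} [Group G] [Fintype G]

omit [Group G] in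
lemma charInner_eq_sum (φ ψ : G → ℂ) :
    charInner G φ ψ = (Nat.card G : ℂ)⁻¹ * ∑ g : G, φ g * (starRingEnd ℂ) (ψ g) := by
  rw [charInner, finsum_eq_sum_of_fintype]

omit [Group G] in
lemma conj_charInner (φ ψ : G → ℂ) :
    (starRingEnd ℂ) (charInner G φ ψ) = charInner G ψ φ := by
  simp [charInner_eq_sum, mul_comm]

omit [Group G] in
lemma charInner_ne_zero_comm (φ ψ : G → ℂ) :
    charInner G φ ψ ≠ 0 ↔ charInner G ψ φ ≠ 0 := by
  rw [← conj_charInner, Ne, map_eq_zero]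

/-- For a finite group, the complex character of the inverse is the conjugate. -/
lemma Representation.char_inv_eq_conj {V : Type} [AddCommGroup V] [Module ℂ V]
    [FiniteDimensional ℂ V] (ρ : Representation ℂ G V) (g : G) :
    ρ.character g⁻¹ = (starRingEnd ℂ) (ρ.character g) := by
  classical
  let b := Module.finBasis ℂ V
  let M : G → Matrix _ _ ℂ := fun g => LinearMap.toMatrix b b (ρ g)
  have hM : ∀ x y, M (x * y) = M x * M y := fun x y => by
    simp only [M, map_mul]
    exact LinearMap.toMatrix_mul b _ _
  have hM1 : M 1 = 1 := by simp [M, LinearMap.toMatrix_one]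
  have htr : ∀ x, ρ.character x = (M x).trace := fun x => by
    simp only [Representation.character, M]
    exact LinearMap.trace_eq_matrix_trace ℂ b _
  let P := ∑ x : G, (M x).conjTranspose * M x
  have hP : P.PosDef := by
    simp only [P]
    rw [← Finset.add_sum_erase _ _ (Finset.mem_univ (1 : G)), hM1]
    refine Matrix.PosDef.add_posSemidef (by simpa using Matrix.PosDef.one) ?_
    exact Matrix.posSemidef_sum _ fun x _ => Matrix.posSemidef_conjTranspose_mul_self _
  have hinv : (M g).conjTranspose * P = P * M g⁻¹ := by
    have h1 : (M g).conjTranspose * P * M g = P := by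
      simp only [P, Finset.mul_sum, Finset.sum_mul]
      refine Fintype.sum_bijective (· * g) (Group.mulRight_bijective g) _ _ fun x => ?_
      simp only [hM, Matrix.conjTranspose_mul, Matrix.mul_assoc]
    calc (M g).conjTranspose * P = (M g).conjTranspose * P * (M g * M g⁻¹) := by
          rw [← hM, mul_inv_cancel, hM1, mul_one]
      _ = P * M g⁻¹ := by rw [← Matrix.mul_assoc, h1]
  have hu : IsUnit P.det := (Matrix.isUnit_iff_isUnit_det _).1 hP.isUnit
  rw [htr, htr, starRingEnd_apply, ← Matrix.trace_conjTranspose]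
  calc (M g⁻¹).trace = (P⁻¹ * (P * M g⁻¹)).trace := by
        rw [Matrix.nonsing_inv_mul_cancel_left _ _ hu]
    _ = (M g).conjTranspose.trace := by
        rw [← hinv, Matrix.trace_mul_comm, Matrix.mul_nonsing_inv_cancel_right _ _ hu]

lemma FDRep.char_inv_eq_conj (V : FDRep ℂ G) (g : G) :
    V.character g⁻¹ = (starRingEnd ℂ) (V.character g) :=
  Representation.char_inv_eq_conj (V := V) V.ρ g

lemma charInner_fdRep_nonneg (V W : FDRep ℂ G) :
    0 ≤ charInner G V.character W.character := by
  have : Invertible (Nat.card G : ℂ) := invertibleOfNonzero (by simp)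
  rw [charInner_eq_sum]
  simp only [← FDRep.char_inv_eq_conj]
  rw [FDRep.scalar_product_char_eq_finrank_equivariant]
  exact Nat.cast_nonneg _

/-- Restriction of a finite-dimensional representation to a subgroup. -/
def FDRep.restrict (V : FDRep ℂ G) (K : Subgroup G) : FDRep ℂ K :=
  FDRep.of (V := V) (V.ρ.comp K.subtype)

omit [Fintype G] in
lemma FDRep.character_restrict (V : FDRep ℂ G) (K : Subgroup G) :
    (V.restrict K).character = resChar K V.character := rfl

omit [Fintype G] in
lemma sum_subgroup_char_mul_conj_nonneg (V W : FDRep ℂ G) (K : Subgroup G) [Fintype K] :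
    0 ≤ ∑ k : K, V.character k * (starRingEnd ℂ) (W.character k) := by
  have h := charInner_fdRep_nonneg (V.restrict K) (W.restrict K)
  rw [charInner_eq_sum] at h
  have h2 := mul_nonneg (Nat.cast_nonneg (α := ℂ) (Nat.card K)) h
  rwa [mul_inv_cancel_left₀ (by simp)] at h2

omit [Fintype G] in
lemma IsIrrChar.conj_apply {χ : G → ℂ} (h : IsIrrChar G χ) (g x : G) :
    χ (x * g * x⁻¹) = χ g := by
  obtain ⟨V, -, rfl⟩ := h
  exact FDRep.char_conj V g x

lemma charInner_irr_self {χ : G → ℂ} (h : IsIrrChar G χ) : charInner G χ χ = 1 := by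
  obtain ⟨V, hV, rfl⟩ := h
  have : Invertible (Nat.card G : ℂ) := invertibleOfNonzero (by simp)
  rw [charInner_eq_sum]
  simp only [← FDRep.char_inv_eq_conj]
  rw [FDRep.char_orthonormal, if_pos ⟨CategoryTheory.Iso.refl V⟩]

lemma charInner_irr_of_ne {χ ψ : G → ℂ} (h : IsIrrChar G χ) (h' : IsIrrChar G ψ)
    (hne : χ ≠ ψ) : charInner G χ ψ = 0 := by
  obtain ⟨V, hV, rfl⟩ := h
  obtain ⟨W, hW, rfl⟩ := h'
  have : Invertible (Nat.card G : ℂ) := invertibleOfNonzero (by simp)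
  rw [charInner_eq_sum]
  simp only [← FDRep.char_inv_eq_conj]
  rw [FDRep.char_orthonormal, if_neg fun ⟨i⟩ => hne (FDRep.char_iso i)]

lemma isIrrChar_of_charInner_self {V : FDRep ℂ G}
    (h : charInner G V.character V.character = 1) : IsIrrChar G V.character := by
  refine ⟨V, (FDRep.simple_iff_char_is_norm_one V).2 ?_, rfl⟩
  rw [charInner_eq_sum] at h
  simp only [← FDRep.char_inv_eq_conj] at h
  exact (inv_mul_eq_one₀ (by simp)).1 h |>.symm

lemma Representation.isIrrChar_character {V : Type} [AddCommGroup V] [Module ℂ V]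
    [FiniteDimensional ℂ V] (ρ : Representation ℂ G V) [ρ.IsIrreducible] :
    IsIrrChar G ρ.character := by
  have : Invertible (Nat.card G : ℂ) := invertibleOfNonzero (by simp)
  refine isIrrChar_of_charInner_self (V := FDRep.of ρ) ?_
  have h := Representation.char_orthonormal ρ ρ
  rw [if_pos ⟨Representation.Equiv.refl ρ⟩] at h
  rw [charInner_eq_sum]
  simp only [← FDRep.char_inv_eq_conj]
  exact h

lemma isIrrChar_monoidHom (l : G →* ℂ) : IsIrrChar G l := by
  let V : FDRep ℂ G := FDRep.of ((Algebra.lmul ℂ ℂ : ℂ →* Module.End ℂ ℂ).comp l)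
  have hV : V.character = l := by
    ext g
    exact Algebra.trace_self_apply (R := ℂ) (l g)
  rw [← hV]
  apply isIrrChar_of_charInner_self
  rw [charInner_eq_sum]
  simp only [← FDRep.char_inv_eq_conj]
  simp only [hV, ← map_mul, mul_inv_cancel, map_one]
  simp

lemma IsIrrChar.apply_one_pos {χ : G → ℂ} (h : IsIrrChar G χ) : 0 < χ 1 := by
  have h1 := charInner_irr_self h
  obtain ⟨V, hV, rfl⟩ := h
  rw [FDRep.char_one]
  refine Nat.cast_pos.2 (Nat.pos_of_ne_zero fun h0 => ?_)
  have hs : Subsingleton V := Module.finrank_zero_iff.1 h0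
  have : ∀ g, V.character g = 0 := fun g => by
    rw [FDRep.character, Subsingleton.elim (V.ρ g) 0, map_zero]
  simp [charInner_eq_sum, this] at h1

/-- A class function orthogonal to an irreducible character acts as zero on it. -/
lemma Representation.sum_smul_eq_zero {V : Type} [AddCommGroup V] [Module ℂ V]
    [FiniteDimensional ℂ V] (ρ : Representation ℂ G V) [ρ.IsIrreducible] {f : G → ℂ}
    (hf : ∀ g x, f (x * g * x⁻¹) = f g) (h : ∑ g, f g * ρ.character g = 0) :
    ∑ g, f g • ρ g = 0 := by
  let T : Representation.IntertwiningMap ρ ρ :=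
    { toLinearMap := ∑ g, f g • ρ g
      isIntertwining' := fun x => by
        change (∑ g, f g • ρ g) * ρ x = ρ x * ∑ g, f g • ρ g
        rw [Finset.sum_mul, Finset.mul_sum]
        refine Fintype.sum_bijective _ (MulAut.conj x⁻¹).bijective _ _ fun g => ?_
        have h1 : f (MulAut.conj x⁻¹ g) = f g := by simpa using hf g x⁻¹
        rw [h1, smul_mul_assoc, mul_smul_comm, ← map_mul, ← map_mul]
        simp [mul_assoc] }
  obtain ⟨c, hc⟩ :=
    (Representation.IsIrreducible.algebraMap_intertwiningMap_bijective_of_isAlgClosed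
      (ρ := ρ)).2 T
  have hT : ∑ g, f g • ρ g = c • (1 : Module.End ℂ V) := by
    change T.toLinearMap = _
    rw [← hc]
    rfl
  have htr := congrArg (LinearMap.trace ℂ V) hT
  simp only [map_sum, map_smul, LinearMap.trace_one, smul_eq_mul] at htr
  have hc0 : c * (Module.finrank ℂ V : ℂ) = 0 := htr.symm.trans h
  have hd : (Module.finrank ℂ V : ℂ) ≠ 0 := by
    rw [← Representation.char_one ρ]
    exact (ρ.isIrrChar_character).apply_one_pos.ne'
  rw [hT, (mul_eq_zero.1 hc0).resolve_right hd, zero_smul]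

lemma sum_single_smul_eq_zero {M : Type} [AddCommGroup M] [Module ℂ M]
    [Module (MonoidAlgebra ℂ G) M] [IsScalarTower ℂ (MonoidAlgebra ℂ G) M]
    [IsSimpleModule (MonoidAlgebra ℂ G) M] {f : G → ℂ}
    (hf : ∀ g x, f (x * g * x⁻¹) = f g)
    (h : ∀ χ, IsIrrChar G χ → ∑ g, f g * χ g = 0) (v : M) :
    (∑ g, MonoidAlgebra.single g (f g) : MonoidAlgebra ℂ G) • v = 0 := by
  let ρ : Representation ℂ G M := Representation.ofModule' M
  have hρ : ∀ z : MonoidAlgebra ℂ G, ∀ w : M, ρ.asAlgebraHom z w = z • w := fun z w => by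
    have : ρ.asAlgebraHom = Algebra.lsmul ℂ ℂ M := Equiv.apply_symm_apply _ _
    rw [this]
    rfl
  let e : ρ.asModule ≃ₗ[MonoidAlgebra ℂ G] M :=
    { ρ.asModuleEquiv.toAddEquiv with
      map_smul' := fun z w => (ρ.asModuleEquiv_map_smul z w).trans (hρ z _) }
  have hirr : ρ.IsIrreducible :=
    (Representation.irreducible_iff_isSimpleModule_asModule ρ).2 (IsSimpleModule.congr e)
  have hfin : FiniteDimensional ℂ M := Module.Finite.trans (MonoidAlgebra ℂ G) M
  have hz : ρ.asAlgebraHom (∑ g, MonoidAlgebra.single g (f g)) = 0 := by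
    rw [← ρ.sum_smul_eq_zero hf (h _ ρ.isIrrChar_character)]
    simp [Representation.asAlgebraHom_single]
  rw [← hρ, hz, LinearMap.zero_apply]

/-- A class function orthogonal to all irreducible characters vanishes. -/
lemma eq_zero_of_sum_mul_irr {f : G → ℂ} (hf : ∀ g x, f (x * g * x⁻¹) = f g)
    (h : ∀ χ, IsIrrChar G χ → ∑ g, f g * χ g = 0) : f = 0 := by
  classical
  let z : MonoidAlgebra ℂ G := ∑ g, MonoidAlgebra.single g (f g)
  have hz : z ∈ Ring.jacobson (MonoidAlgebra ℂ G) := by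
    rw [Ring.jacobson_eq_sInf_isMaximal, Submodule.mem_sInf]
    intro m hm
    have : Ideal.IsMaximal m := hm
    have hs : IsSimpleModule (MonoidAlgebra ℂ G) (MonoidAlgebra ℂ G ⧸ m) :=
      isSimpleModule_iff_isCoatom.2 this.out
    have h1 := sum_single_smul_eq_zero hf h (Submodule.Quotient.mk (p := m) 1)
    rwa [← Submodule.Quotient.mk_smul, Submodule.Quotient.mk_eq_zero, smul_eq_mul,
      mul_one] at h1
  rw [IsSemisimpleRing.jacobson_eq_bot] at hz
  have hz0 : z = 0 := hz
  ext g
  have := congrArg (fun w : MonoidAlgebra ℂ G => w.coeff g) hz0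
  simpa [z, Finsupp.single_apply] using this

lemma finite_setOf_isIrrChar : {χ : G → ℂ | IsIrrChar G χ}.Finite := by
  refine LinearIndependent.setFinite (R := ℂ) ?_
  rw [linearIndependent_iff']
  intro s c hc i hi
  have h1 : charInner G (∑ j ∈ s, c j • (j : G → ℂ)) i = 0 := by
    rw [hc]
    simp [charInner_eq_sum]
  have h2 : charInner G (∑ j ∈ s, c j • (j : G → ℂ)) i =
      ∑ j ∈ s, c j * charInner G j i := by
    simp only [charInner_eq_sum, Finset.sum_apply, Pi.smul_apply, smul_eq_mul, Finset.sum_mul,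
      Finset.mul_sum]
    rw [Finset.sum_comm]
    refine Finset.sum_congr rfl fun j _ => Finset.sum_congr rfl fun g _ => by ring
  rw [h2, Finset.sum_eq_single i, charInner_irr_self i.2, mul_one] at h1
  · exact h1
  · intro j _ hji
    rw [charInner_irr_of_ne j.2 i.2 (fun h => hji (Subtype.ext h)), mul_zero]
  · exact fun h => absurd hi h

/-- Parseval's identity for class functions on a finite group. -/
lemma charInner_eq_sum_irr {f : G → ℂ} (hf : ∀ g x, f (x * g * x⁻¹) = f g) (k : G → ℂ) :
    charInner G f k = ∑ χ ∈ (finite_setOf_isIrrChar (G := G)).toFinset,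
      charInner G f χ * charInner G χ k := by
  set S := (finite_setOf_isIrrChar (G := G)).toFinset with hS
  have hmem : ∀ χ ∈ S, IsIrrChar G χ := fun χ hχ => by simpa [hS] using hχ
  have hlin : ∀ k : G → ℂ, charInner G (∑ χ ∈ S, charInner G f χ • χ) k =
      ∑ χ ∈ S, charInner G f χ * charInner G χ k := fun k => by
    simp only [charInner_eq_sum _ k, Finset.sum_apply, Pi.smul_apply, smul_eq_mul,
      Finset.sum_mul, Finset.mul_sum]
    rw [Finset.sum_comm]
    refine Finset.sum_congr rfl fun j _ => Finset.sum_congr rfl fun g _ => by ring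
  have hfS : f = ∑ χ ∈ S, charInner G f χ • χ := by
    let d : G → ℂ := fun g => f g⁻¹ - (∑ χ ∈ S, charInner G f χ • χ) g⁻¹
    have hd : d = 0 := by
      refine eq_zero_of_sum_mul_irr (fun g x => ?_) fun χ hχ => ?_
      · have hx : (x * g * x⁻¹)⁻¹ = x * g⁻¹ * x⁻¹ := by group
        simp only [d, hx, hf, Finset.sum_apply, Pi.smul_apply]
        congr 1
        refine Finset.sum_congr rfl fun χ hχ => ?_
        rw [(hmem χ hχ).conj_apply]
      · have h1 : charInner G (∑ χ ∈ S, charInner G f χ • χ) χ = charInner G f χ := by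
          rw [hlin, Finset.sum_eq_single χ, charInner_irr_self hχ, mul_one]
          · intro ψ hψ hne
            rw [charInner_irr_of_ne (hmem ψ hψ) hχ hne, mul_zero]
          · exact fun hn => absurd (by simpa [hS] using hχ) hn
        have h2 := h1
        rw [charInner_eq_sum, charInner_eq_sum, mul_right_inj' (by simp)] at h2
        rw [← Equiv.sum_comp (Equiv.inv G)]
        obtain ⟨V, -, rfl⟩ := hχ
        simp only [Equiv.inv_apply, d, inv_inv, FDRep.char_inv_eq_conj, sub_mul,
          Finset.sum_sub_distrib]
        rw [h2, sub_self]
    ext g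
    have := congrFun hd g⁻¹
    simpa [d, sub_eq_zero] using this
  conv_lhs => rw [hfS]
  exact hlin k

lemma exists_irr_of_charInner_ne_zero {f k : G → ℂ} (hf : ∀ g x, f (x * g * x⁻¹) = f g)
    (h : charInner G f k ≠ 0) :
    ∃ χ, IsIrrChar G χ ∧ charInner G f χ ≠ 0 ∧ charInner G χ k ≠ 0 := by
  rw [charInner_eq_sum_irr hf] at h
  obtain ⟨χ, hχ, hne⟩ := Finset.exists_ne_zero_of_sum_ne_zero h
  exact ⟨χ, by simpa using hχ, left_ne_zero_of_mul hne, right_ne_zero_of_mul hne⟩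

lemma charInner_ne_zero_of_irr {f k χ : G → ℂ} (hf : ∀ g x, f (x * g * x⁻¹) = f g)
    (hf0 : ∀ ψ, IsIrrChar G ψ → 0 ≤ charInner G f ψ)
    (hk0 : ∀ ψ, IsIrrChar G ψ → 0 ≤ charInner G ψ k)
    (hχ : IsIrrChar G χ) (h1 : charInner G f χ ≠ 0) (h2 : charInner G χ k ≠ 0) :
    charInner G f k ≠ 0 := by
  rw [charInner_eq_sum_irr hf]
  refine (Finset.sum_pos' (fun ψ hψ => ?_) ⟨χ, by simpa using hχ, ?_⟩).ne'
  · have hψ : IsIrrChar G ψ := by simpa using hψ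
    exact mul_nonneg (hf0 ψ hψ) (hk0 ψ hψ)
  · exact mul_pos ((hf0 χ hχ).lt_of_ne' h1) ((hk0 χ hχ).lt_of_ne' h2)

end CharacterTheory

section Induction

variable {G : Type} [Group G] [Fintype G] (H : Subgroup G)

open scoped Classical in
/-- Extension by zero of a function on a subgroup. -/
def extendByZero (α : H → ℂ) (g : G) : ℂ := if hg : g ∈ H then α ⟨g, hg⟩ else 0

/-- The class function on `G` induced from `α : H → ℂ`. -/
def indChar (α : H → ℂ) (g : G) : ℂ :=
  (Nat.card H : ℂ)⁻¹ * ∑ x : G, extendByZero H α (x⁻¹ * g * x)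

/-- The permutation character of `H` on the coset space `G ⧸ H`. -/
def cosetChar (h : H) : ℂ := (Nat.card (MulAction.fixedBy (G ⧸ H) h) : ℂ)

lemma sum_extendByZero_mul (α : H → ℂ) (F : G → ℂ) :
    ∑ g : G, extendByZero H α g * F g = ∑ᶠ h : H, α h * F h := by
  classical
  rw [finsum_eq_sum_of_fintype, ← Finset.sum_filter_of_ne (p := (· ∈ H)),
    Finset.sum_subtype (p := (· ∈ H)) _ (by simp)]
  · exact Finset.sum_congr rfl fun h _ => by rw [extendByZero, dif_pos h.2]
  · intro g _ hg
    by_contra hgH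
    rw [extendByZero, dif_neg hgH, zero_mul] at hg
    exact hg rfl

lemma indChar_conj (α : H → ℂ) (g y : G) :
    indChar H α (y * g * y⁻¹) = indChar H α g := by
  unfold indChar
  congr 1
  refine Fintype.sum_bijective (y⁻¹ * ·) (Group.mulLeft_bijective _) _ _ fun x => ?_
  congr 1
  group

/-- Frobenius reciprocity. -/
lemma charInner_indChar (α : H → ℂ) {χ : G → ℂ} (hχ : ∀ g x, χ (x * g * x⁻¹) = χ g) :
    charInner G (indChar H α) χ = charInner H α (resChar H χ) := by
  have h0 := sum_extendByZero_mul H α fun g => starRingEnd ℂ (χ g)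
  rw [charInner_eq_sum, charInner]
  simp only [resChar]
  rw [← h0]
  have h1 : ∀ x : G, ∑ g, extendByZero H α (x⁻¹ * g * x) * starRingEnd ℂ (χ g) =
      ∑ g, extendByZero H α g * starRingEnd ℂ (χ g) := fun x => by
    refine Fintype.sum_bijective _ (MulAut.conj x⁻¹).bijective _ _ fun g => ?_
    have := hχ g x⁻¹
    simp only [MulAut.conj_apply, inv_inv] at this ⊢
    rw [this]
  have h2 : ∑ g, indChar H α g * starRingEnd ℂ (χ g) = (Nat.card H : ℂ)⁻¹ *
      ∑ x : G, ∑ g, extendByZero H α (x⁻¹ * g * x) * starRingEnd ℂ (χ g) := by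
    rw [Finset.sum_comm, Finset.mul_sum]
    simp only [indChar, mul_assoc, Finset.sum_mul]
  rw [h2]
  simp only [h1, Finset.sum_const, Finset.card_univ, nsmul_eq_mul, ← Nat.card_eq_fintype_card]
  have : (Nat.card G : ℂ) ≠ 0 := by simp
  field_simp

lemma indChar_coe {α : H → ℂ} (hα : ∀ g x, α (x * g * x⁻¹) = α g)
    (hfus : ∀ h ∈ H, ∀ x : G, x⁻¹ * h * x ∈ H → ∃ k ∈ H, k * h * k⁻¹ = x⁻¹ * h * x) (h : H) :
    indChar H α h = α h * cosetChar H h := by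
  classical
  have h1 : ∀ x : G, extendByZero H α (x⁻¹ * h * x) =
      if x ∈ (QuotientGroup.mk ⁻¹' MulAction.fixedBy (G ⧸ H) h : Set G) then α h else 0 := by
    intro x
    have hmem : x ∈ (QuotientGroup.mk ⁻¹' MulAction.fixedBy (G ⧸ H) h : Set G) ↔
        x⁻¹ * h * x ∈ H := by
      rw [Set.mem_preimage, MulAction.mem_fixedBy, eq_comm]
      rw [mul_assoc]
      exact QuotientGroup.eq
    by_cases hx : x⁻¹ * h * x ∈ H
    · rw [if_pos (hmem.2 hx), extendByZero, dif_pos hx]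
      obtain ⟨k, hk, hkx⟩ := hfus h h.2 x hx
      rw [← hα h ⟨k, hk⟩]
      congr 1
      exact Subtype.ext hkx.symm
    · rw [if_neg (mt hmem.1 hx), extendByZero, dif_neg hx]
  have h2 := QuotientGroup.card_preimage_mk H (MulAction.fixedBy (G ⧸ H) h)
  rw [indChar, Finset.sum_congr rfl fun x _ => h1 x, ← Finset.sum_filter, Finset.sum_const,
    nsmul_eq_mul, ← Fintype.card_subtype, ← Nat.card_eq_fintype_card]
  change _ * ((Nat.card (QuotientGroup.mk ⁻¹' MulAction.fixedBy (G ⧸ H) h : Set G) : ℂ) * _) = _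
  rw [h2, cosetChar]
  have : (Nat.card H : ℂ) ≠ 0 := by simp
  push_cast
  field_simp

lemma linked_iff
    (hfus : ∀ h ∈ H, ∀ x : G, x⁻¹ * h * x ∈ H → ∃ k ∈ H, k * h * k⁻¹ = x⁻¹ * h * x)
    {α β : H → ℂ} (hα : IsIrrChar H α) (hβ : IsIrrChar H β) :
    Linked H α β ↔ charInner H α (β * cosetChar H) ≠ 0 := by
  classical
  have hind : charInner G (indChar H α) (indChar H β) = charInner H α (β * cosetChar H) := by
    rw [charInner_indChar H α (indChar_conj H β)]
    congr 1
    ext h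
    exact indChar_coe H hβ.conj_apply hfus h
  have hfrob : ∀ {γ : H → ℂ} {ψ : G → ℂ}, IsIrrChar G ψ →
      charInner G ψ (indChar H γ) = charInner H (resChar H ψ) γ := fun hψ => by
    rw [← conj_charInner, charInner_indChar _ _ hψ.conj_apply, conj_charInner]
  have hnonneg : ∀ {γ : H → ℂ} {ψ : G → ℂ}, IsIrrChar H γ → IsIrrChar G ψ →
      0 ≤ charInner H (resChar H ψ) γ := by
    rintro _ _ ⟨V, -, rfl⟩ ⟨W, -, rfl⟩
    rw [← FDRep.character_restrict]
    exact charInner_fdRep_nonneg _ _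
  rw [← hind]
  constructor
  · rintro ⟨χ, hχ, h1, h2⟩
    refine charInner_ne_zero_of_irr (indChar_conj H α) (fun ψ hψ => ?_) (fun ψ hψ => ?_) hχ ?_ ?_
    · rw [← conj_charInner, hfrob hψ]
      exact star_nonneg_iff.2 (hnonneg hα hψ)
    · rw [hfrob hψ]
      exact hnonneg hβ hψ
    · rwa [charInner_ne_zero_comm, hfrob hχ]
    · rwa [hfrob hχ]
  · intro h
    obtain ⟨χ, hχ, h1, h2⟩ := exists_irr_of_charInner_ne_zero (indChar_conj H α) h
    rw [charInner_ne_zero_comm, hfrob hχ] at h1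
    rw [hfrob hχ] at h2
    exact ⟨χ, hχ, h1, h2⟩

end Induction

section PermutationPowers

/-- Weighted orbit counting: summing fixed-point counts amounts to summing over stabilizers. -/
lemma sum_mul_card_fixedBy {H Y : Type} [Group H] [Fintype H] [Finite Y] [MulAction H Y]
    (F : H → ℂ) : ∑ h, F h * (Nat.card (MulAction.fixedBy Y h) : ℂ) =
      ∑ᶠ y : Y, ∑ᶠ h : MulAction.stabilizer H y, F h := by
  classical
  have := Fintype.ofFinite Y
  simp only [finsum_eq_sum_of_fintype]
  have h1 : ∀ h, F h * (Nat.card (MulAction.fixedBy Y h) : ℂ) =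
      ∑ y : Y, if h • y = y then F h else 0 := fun h => by
    rw [← Finset.sum_filter, Finset.sum_const, nsmul_eq_mul, mul_comm, ← Fintype.card_subtype,
      ← Nat.card_eq_fintype_card]
    rfl
  rw [Finset.sum_congr rfl fun h _ => h1 h, Finset.sum_comm]
  refine Finset.sum_congr rfl fun y _ => ?_
  rw [← Finset.sum_filter]
  exact Finset.sum_subtype _ (by simp) F

lemma card_fixedBy_pi {H X ι : Type} [Group H] [MulAction H X] [Fintype ι] (h : H) :
    Nat.card (MulAction.fixedBy (ι → X) h) =
      Nat.card (MulAction.fixedBy X h) ^ Fintype.card ι := by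
  rw [← Nat.card_eq_fintype_card, ← Nat.card_fun]
  refine Nat.card_congr ⟨fun f i => ⟨f.1 i, congrFun f.2 i⟩,
    fun f => ⟨fun i => f i, funext fun i => (f i).2⟩, fun f => rfl, fun f => rfl⟩

variable {G : Type} [Group G] [Fintype G] (H : Subgroup G)

lemma sum_mul_cosetChar_pow (F : H → ℂ) (n : ℕ) :
    ∑ᶠ h, F h * cosetChar H h ^ n =
      ∑ᶠ f : Fin n → G ⧸ H, ∑ᶠ h : MulAction.stabilizer H f, F h := by
  classical
  rw [finsum_eq_sum_of_fintype, ← sum_mul_card_fixedBy]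
  refine Finset.sum_congr rfl fun h _ => ?_
  have h1 : Nat.card (MulAction.fixedBy (Fin n → G ⧸ H) h) =
      Nat.card (MulAction.fixedBy (G ⧸ H) h) ^ Fintype.card (Fin n) := card_fixedBy_pi h
  rw [h1, Fintype.card_fin, Nat.cast_pow, cosetChar]

lemma charInner_mul_cosetChar_pow (α β : H → ℂ) (n : ℕ) :
    charInner H (α * cosetChar H ^ n) β = (Nat.card H : ℂ)⁻¹ *
      ∑ᶠ f : Fin n → G ⧸ H, ∑ᶠ h : MulAction.stabilizer H f,
        α h * starRingEnd ℂ (β h) := by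
  rw [← sum_mul_cosetChar_pow H (fun h => α h * starRingEnd ℂ (β h)), charInner]
  simp only [Pi.mul_apply, Pi.pow_apply, mul_right_comm]

lemma charInner_mul_cosetChar_pow_nonneg {α β : H → ℂ} (hα : IsIrrChar H α)
    (hβ : IsIrrChar H β) (n : ℕ) : 0 ≤ charInner H (α * cosetChar H ^ n) β := by
  classical
  obtain ⟨V, -, rfl⟩ := hα
  obtain ⟨W, -, rfl⟩ := hβ
  rw [charInner_mul_cosetChar_pow]
  simp only [finsum_eq_sum_of_fintype]
  exact mul_nonneg (by simp) (Finset.sum_nonneg fun f _ => sum_subgroup_char_mul_conj_nonneg V W _)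

lemma charInner_mul_cosetChar_pow_ne_zero {α β : H → ℂ} (hα : IsIrrChar H α)
    (hβ : IsIrrChar H β) {n : ℕ} {f : Fin n → G ⧸ H} (hf : MulAction.stabilizer H f = ⊥) :
    charInner H (α * cosetChar H ^ n) β ≠ 0 := by
  classical
  have hα1 := hα.apply_one_pos
  have hβ1 := hβ.apply_one_pos
  obtain ⟨V, -, rfl⟩ := hα
  obtain ⟨W, -, rfl⟩ := hβ
  rw [charInner_mul_cosetChar_pow]
  simp only [finsum_eq_sum_of_fintype]
  refine mul_ne_zero (by simp) (Finset.sum_pos'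
    (fun f _ => sum_subgroup_char_mul_conj_nonneg V W _) ⟨f, Finset.mem_univ _, ?_⟩).ne'
  have : Unique (MulAction.stabilizer H f) := by rw [hf]; infer_instance
  rw [Fintype.sum_unique, Unique.eq_default (default : MulAction.stabilizer H f),
    Unique.default_eq 1]
  exact mul_pos hα1 (star_pos_iff.2 hβ1)

omit [Fintype G] in
lemma charInner_mul_cosetChar_right (α β : H → ℂ) :
    charInner H α (β * cosetChar H) = charInner H (α * cosetChar H) β := by
  simp only [charInner, Pi.mul_apply, map_mul, cosetChar, map_natCast]
  congr 1
  exact finsum_congr fun h => by ring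

omit [Fintype G] in
lemma cosetChar_conj (h x : H) : cosetChar H (x * h * x⁻¹) = cosetChar H h := by
  rw [cosetChar, cosetChar]
  congr 1
  refine Nat.card_congr ((MulAction.toPerm x⁻¹).subtypeEquiv fun a => ?_)
  simp only [MulAction.mem_fixedBy, MulAction.toPerm_apply, mul_smul]
  exact smul_eq_iff_eq_inv_smul x

end PermutationPowers

section Paths

variable {G : Type} [Group G] (H : Subgroup G)

lemma LinkedPathLE.snoc {n : ℕ} {α β γ : H → ℂ} (h : LinkedPathLE H n α β)
    (hγ : IsIrrChar H γ) (hl : Linked H β γ) : LinkedPathLE H (n + 1) α γ := by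
  obtain ⟨k, hk, f, h0, hfk, hirr, hlink⟩ := h
  refine ⟨k + 1, by omega, fun i => if i ≤ k then f i else γ, by simpa using h0, by simp,
    fun i _ => ?_, fun i hi => ?_⟩
  · by_cases hik : i ≤ k
    · simpa [hik] using hirr i hik
    · simpa [hik] using hγ
  · rcases Nat.lt_succ_iff_lt_or_eq.1 hi with hik | rfl
    · simpa [hik.le, Nat.succ_le_of_lt hik] using hlink i hik
    · simpa [hfk] using hl

lemma mul_cosetChar_pow_conj {α : H → ℂ} (hα : IsIrrChar H α) (n : ℕ) (g x : H) :
    (α * cosetChar H ^ n) (x * g * x⁻¹) = (α * cosetChar H ^ n) g := by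
  simp only [Pi.mul_apply, Pi.pow_apply, hα.conj_apply, cosetChar_conj]

variable [Fintype G]

lemma linkedPathLE_of_charInner_ne_zero
    (hfus : ∀ h ∈ H, ∀ x : G, x⁻¹ * h * x ∈ H → ∃ k ∈ H, k * h * k⁻¹ = x⁻¹ * h * x)
    {α : H → ℂ} (hα : IsIrrChar H α) (n : ℕ) {β : H → ℂ} (hβ : IsIrrChar H β)
    (h : charInner H (α * cosetChar H ^ n) β ≠ 0) : LinkedPathLE H n α β := by
  classical
  induction n generalizing β with
  | zero =>
    have hαβ : α = β := by
      by_contra hne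
      exact h (by simpa using charInner_irr_of_ne hα hβ hne)
    subst hαβ
    exact ⟨0, le_rfl, fun _ => α, rfl, rfl, fun _ _ => hα, fun i hi => absurd hi i.not_lt_zero⟩
  | succ n ih =>
    rw [pow_succ, ← mul_assoc, ← charInner_mul_cosetChar_right] at h
    obtain ⟨χ, hχ, h1, h2⟩ := exists_irr_of_charInner_ne_zero (mul_cosetChar_pow_conj H hα n) h
    exact (ih hχ h1).snoc H hβ ((linked_iff H hfus hχ hβ).2 h2)

lemma LinkedPathLE.exists_charInner_ne_zero
    (hfus : ∀ h ∈ H, ∀ x : G, x⁻¹ * h * x ∈ H → ∃ k ∈ H, k * h * k⁻¹ = x⁻¹ * h * x)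
    {n : ℕ} {α β : H → ℂ} (h : LinkedPathLE H n α β) :
    ∃ k ≤ n, charInner H (α * cosetChar H ^ k) β ≠ 0 := by
  classical
  obtain ⟨k, hk, f, rfl, rfl, hirr, hlink⟩ := h
  have key : ∀ i ≤ k, charInner H (f 0 * cosetChar H ^ i) (f i) ≠ 0 := by
    intro i
    induction i with
    | zero =>
      intro hi
      simp [charInner_irr_self (hirr 0 hi)]
    | succ i ih =>
      intro hi
      have h0 := hirr 0 (Nat.zero_le _)
      rw [pow_succ, ← mul_assoc, ← charInner_mul_cosetChar_right]
      refine charInner_ne_zero_of_irr (mul_cosetChar_pow_conj H h0 i)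
        (fun ψ hψ => charInner_mul_cosetChar_pow_nonneg H h0 hψ i) (fun ψ hψ => ?_)
        (hirr i (by omega)) (ih (by omega))
        ((linked_iff H hfus (hirr i (by omega)) (hirr _ hi)).1 (hlink i hi))
      rw [charInner_mul_cosetChar_right]
      simpa using charInner_mul_cosetChar_pow_nonneg H hψ (hirr _ hi) 1
  exact ⟨k, hk, key k le_rfl⟩

end Paths

section CosetAction

lemma mem_iff_smul_mk_one {G : Type} [Group G] (H : Subgroup G) (g : G) :
    g ∈ H ↔ g • ((1 : G) : G ⧸ H) = (1 : G) := by
  rw [← MulAction.mem_stabilizer_iff, MulAction.stabilizer_quotient]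

/-- If `G` acts on `G ⧸ H` as the full symmetric group, then elements of `H` that are conjugate
in `G` are conjugate in `H`. -/
lemma exists_conj_of_toPermHom_bijective {G : Type} [Group G] {H : Subgroup G}
    (hb : Function.Bijective (MulAction.toPermHom G (G ⧸ H))) {h : G} (hh : h ∈ H) (x : G)
    (hx : x⁻¹ * h * x ∈ H) : ∃ k ∈ H, k * h * k⁻¹ = x⁻¹ * h * x := by
  classical
  let x₀ : G ⧸ H := (1 : G)
  obtain ⟨t, ht⟩ := hb.2 (Equiv.swap x₀ (x • x₀))
  have ht₀ : t • x₀ = x • x₀ := by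
    have := Equiv.congr_fun ht x₀
    rwa [Equiv.swap_apply_left] at this
  have h1 : h • x₀ = x₀ := (mem_iff_smul_mk_one H h).1 hh
  have h2 : h • x • x₀ = x • x₀ := by
    have := (mem_iff_smul_mk_one H _).1 hx
    rwa [mul_smul, mul_smul, inv_smul_eq_iff] at this
  have hcomm : h * t * h⁻¹ = t := by
    apply hb.1
    rw [map_mul, map_mul, map_inv, ht, ← Equiv.swap_apply_apply]
    simp only [MulAction.toPermHom_apply, MulAction.toPerm_apply, h1, h2]
  refine ⟨x⁻¹ * t, (mem_iff_smul_mk_one H _).2 ?_, ?_⟩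
  · change (x⁻¹ * t) • x₀ = x₀
    rw [mul_smul, ht₀, inv_smul_smul]
  · have : t * h = h * t := (mul_inv_eq_iff_eq_mul.1 hcomm).symm
    calc x⁻¹ * t * h * (x⁻¹ * t)⁻¹ = x⁻¹ * (t * h) * t⁻¹ * x := by group
      _ = x⁻¹ * h * x := by rw [this]; group

lemma exists_stabilizer_eq_bot {G : Type} [Group G] [Finite G] {H : Subgroup G}
    (hb : Function.Injective (MulAction.toPermHom G (G ⧸ H))) {n : ℕ}
    (hn : Nat.card (G ⧸ H) = n + 2) :
    ∃ f : Fin n → G ⧸ H, MulAction.stabilizer H f = ⊥ := by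
  classical
  let e₀ : G ⧸ H ≃ Fin (n + 2) := Finite.equivFinOfCardEq hn
  let e := e₀.trans (Equiv.swap (e₀ (1 : G)) (Fin.last (n + 1)))
  have he : e.symm (Fin.last (n + 1)) = (1 : G) := by simp [e]
  refine ⟨fun i => e.symm i.succ.castSucc, (Subgroup.eq_bot_iff_forall _).2 fun h hh => ?_⟩
  have hfix : ∀ j, j ≠ 0 → (h : G) • e.symm j = e.symm j := by
    intro j hj
    induction j using Fin.lastCases with
    | last =>
      rw [he]
      exact (mem_iff_smul_mk_one H _).1 h.2
    | cast j =>
      have hj0 : j ≠ 0 := fun h0 => hj (by rw [h0]; rfl)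
      obtain ⟨i, rfl⟩ := Fin.exists_succ_eq.2 hj0
      exact congrFun hh i
  refine Subtype.ext (hb ?_)
  ext y
  change (h : G) • y = (1 : G) • y
  rw [one_smul]
  by_contra hy
  have h0 : ∀ z, (h : G) • z ≠ z → e z = 0 := fun z hz => by
    by_contra hne
    exact hz (by simpa using hfix (e z) hne)
  have h1 : (h : G) • (h : G) • y ≠ (h : G) • y := fun h2 => hy (MulAction.injective _ h2)
  exact hy (e.injective ((h0 _ h1).trans (h0 y hy).symm))

open scoped Classical in
/-- The sign of the permutation induced by an element of `H` on `G ⧸ H`. -/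
def cosetSign {G : Type} [Group G] [Fintype G] (H : Subgroup G) : H →* ℂ :=
  ((Int.castRingHom ℂ : ℤ →* ℂ).comp (Units.coeHom ℤ)).comp
    (Equiv.Perm.sign.comp ((MulAction.toPermHom G (G ⧸ H)).comp H.subtype))

lemma charInner_cosetChar_pow_cosetSign {G : Type} [Group G] [Fintype G] {H : Subgroup G}
    (hb : Function.Surjective (MulAction.toPermHom G (G ⧸ H))) {k : ℕ}
    (hk : k + 3 ≤ Nat.card (G ⧸ H)) :
    charInner H ((1 : H →* ℂ) * cosetChar H ^ k) (cosetSign H) = 0 := by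
  classical
  rw [charInner_mul_cosetChar_pow]
  simp only [finsum_eq_sum_of_fintype]
  rw [Finset.sum_eq_zero, mul_zero]
  intro f _
  let s : Finset (G ⧸ H) := insert ((1 : G) : G ⧸ H) (Finset.univ.image f)
  have hs : 1 < sᶜ.card := by
    have h1 : s.card ≤ k + 1 := (Finset.card_insert_le _ _).trans
      (Nat.succ_le_succ (Finset.card_image_le.trans (by simp)))
    rw [Finset.card_compl, ← Nat.card_eq_fintype_card]
    omega
  obtain ⟨p, hp, q, hq, hpq⟩ := Finset.one_lt_card.1 hs
  rw [Finset.mem_compl] at hp hq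
  obtain ⟨t, ht⟩ := hb (Equiv.swap p q)
  have hfix : ∀ x ∈ s, t • x = x := fun x hx => by
    have := Equiv.congr_fun ht x
    rwa [Equiv.swap_apply_of_ne_of_ne (ne_of_mem_of_not_mem hx hp)
      (ne_of_mem_of_not_mem hx hq)] at this
  have htH : t ∈ H := (mem_iff_smul_mk_one H t).2 (hfix _ (Finset.mem_insert_self _ _))
  let u : MulAction.stabilizer H f := ⟨⟨t, htH⟩, funext fun i =>
    hfix _ (Finset.mem_insert_of_mem (Finset.mem_image_of_mem f (Finset.mem_univ i)))⟩
  have hu : cosetSign H u = -1 := by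
    change (((Equiv.Perm.sign (MulAction.toPermHom G (G ⧸ H) t) : ℤˣ) : ℤ) : ℂ) = -1
    rw [ht, Equiv.Perm.sign_swap hpq]
    simp
  have hsum : ∑ h : MulAction.stabilizer H f, (1 : H →* ℂ) h * starRingEnd ℂ (cosetSign H h) =
      -∑ h : MulAction.stabilizer H f, (1 : H →* ℂ) h * starRingEnd ℂ (cosetSign H h) := by
    rw [← Finset.sum_neg_distrib]
    refine Fintype.sum_bijective (u * ·) (Group.mulLeft_bijective u) _ _ fun h => ?_
    simp [hu]
  exact self_eq_neg.1 hsum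

lemma card_quotient_of_card_eq_factorial {n : ℕ} (hn : 0 < n) {H : Subgroup (Equiv.Perm (Fin n))}
    (hH : Nat.card H = (n - 1).factorial) : Nat.card (Equiv.Perm (Fin n) ⧸ H) = n := by
  have h1 := H.card_eq_card_quotient_mul_card_subgroup
  rw [hH, Nat.card_perm, Nat.card_fin, ← Nat.mul_factorial_pred hn.ne'] at h1
  exact (Nat.eq_of_mul_eq_mul_right (Nat.factorial_pos _) h1).symm

lemma toPermHom_quotient_bijective {n : ℕ} (hn : 5 ≤ n) {H : Subgroup (Equiv.Perm (Fin n))}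
    (hH : Nat.card H = (n - 1).factorial) :
    Function.Bijective (MulAction.toPermHom (Equiv.Perm (Fin n)) (Equiv.Perm (Fin n) ⧸ H)) := by
  classical
  have hinj : Function.Injective
      (MulAction.toPermHom (Equiv.Perm (Fin n)) (Equiv.Perm (Fin n) ⧸ H)) := by
    rw [← MonoidHom.ker_eq_bot_iff, ← Subgroup.normalCore_eq_ker]
    by_contra hne
    have hle : alternatingGroup (Fin n) ≤ H :=
      (Equiv.Perm.alternatingGroup_le_of_normal (by simpa using hn)
        ((Subgroup.nontrivial_iff_ne_bot _).2 hne)).trans H.normalCore_le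
    have hcard := Subgroup.card_le_of_le hle
    have : Nontrivial (Fin n) := Fin.nontrivial_iff_two_le.2 (by omega)
    have h2 := two_mul_nat_card_alternatingGroup (α := Fin n)
    rw [Nat.card_perm, Nat.card_fin, ← Nat.mul_factorial_pred (by omega)] at h2
    have := Nat.factorial_pos (n - 1)
    nlinarith
  refine (Nat.bijective_iff_injective_and_card _).2 ⟨hinj, ?_⟩
  rw [Nat.card_perm, Nat.card_perm, card_quotient_of_card_eq_factorial (by omega) hH,
    Nat.card_fin]

end CosetAction

/-- Let `G = S₆` and let `H ≤ G` be a transitive subgroup abstractly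
isomorphic to `S₅` (so `H` is primitive, isomorphic to `PGL₂(5)`). Then the Külshammer
graph `K(G,H)` has diameter exactly 4 (equivalently, `d_G(H) = 9`). -/
theorem kulshammer_S6_primitive_S5 (H : Subgroup (Equiv.Perm (Fin 6)))
    (htrans : ∀ a b : Fin 6, ∃ h ∈ H, h a = b)
    (hiso : Nonempty (↥H ≃* Equiv.Perm (Fin 5))) :
    (∀ α β : ↥H → ℂ, IsIrrChar ↥H α → IsIrrChar ↥H β → LinkedPathLE H 4 α β) ∧
    (∃ α β : ↥H → ℂ, IsIrrChar ↥H α ∧ IsIrrChar ↥H β ∧ ¬ LinkedPathLE H 3 α β) := by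
  have hcard : Nat.card H = (6 - 1).factorial := by
    rw [Nat.card_congr hiso.some.toEquiv, Nat.card_perm, Nat.card_fin]
  have hindex : Nat.card (Equiv.Perm (Fin 6) ⧸ H) = 6 :=
    card_quotient_of_card_eq_factorial (by norm_num) hcard
  have hb := toPermHom_quotient_bijective (by norm_num) hcard
  have hfus : ∀ h ∈ H, ∀ x : Equiv.Perm (Fin 6), x⁻¹ * h * x ∈ H →
      ∃ k ∈ H, k * h * k⁻¹ = x⁻¹ * h * x := fun h hh x hx =>
    exists_conj_of_toPermHom_bijective hb hh x hx
  constructor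
  · intro α β hα hβ
    obtain ⟨f, hf⟩ := exists_stabilizer_eq_bot hb.1 hindex
    exact linkedPathLE_of_charInner_ne_zero H hfus hα 4 hβ
      (charInner_mul_cosetChar_pow_ne_zero H hα hβ hf)
  · classical
    refine ⟨(1 : H →* ℂ), cosetSign H, isIrrChar_monoidHom _, isIrrChar_monoidHom _, fun hp => ?_⟩
    obtain ⟨k, hk, hne⟩ := hp.exists_charInner_ne_zero H hfus
    exact hne (charInner_cosetChar_pow_cosetSign hb.2 (by omega))
end
end

section
/- Let G = S₆ be the symmetric group on {1,…,6} and let H be the stabilizer in G of the partition {{1,2},{3,4},{5,6}}, i.e., the subgroup of all g ∈ G that permute these three blocks among themselves (so H is isomorphic to the wreath product S₂ ≀ S₃, of order 48). Then the Külshammer graph K(G,H) has diameter exactly 3: any two irreducible complex characters of H are joined by a path of length at most 3 in K(G,H), and there exist two irreducible complex characters of H joined by no path of length at most 2. (Equivalently, d_G(H) = 7.) -/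
noncomputable section

open Module

/-- The character of a representation splits along a decomposition into complementary
subrepresentations. -/
lemma Representation.character_eq_add_of_isCompl {G V : Type} [Group G] [AddCommGroup V]
    [Module ℂ V] [FiniteDimensional ℂ V] (ρ : Representation ℂ G V) (σ τ : Subrepresentation ρ)
    (h : IsCompl σ.toSubmodule τ.toSubmodule) :
    ρ.character = σ.toRepresentation.character + τ.toRepresentation.character := by
  funext g
  have hint : DirectSum.IsInternal (fun b : Bool => bif b then σ.toSubmodule else τ.toSubmodule) :=
    (DirectSum.isInternal_submodule_iff_isCompl _ (i := true) (j := false) (by decide)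
      (by ext b; cases b <;> simp)).2 h
  have hmaps : ∀ b : Bool, Set.MapsTo (ρ g) ((bif b then σ.toSubmodule else τ.toSubmodule :
      Submodule ℂ V) : Set V) ((bif b then σ.toSubmodule else τ.toSubmodule : Submodule ℂ V)) := by
    rintro (_ | _)
    · exact fun v hv => τ.apply_mem_toSubmodule g hv
    · exact fun v hv => σ.apply_mem_toSubmodule g hv
  have := LinearMap.trace_eq_sum_trace_restrict hint hmaps
  rw [Fintype.sum_bool] at this
  exact this

/-- Every character is a finite sum of characters of irreducible representations. -/
theorem Representation.exists_character_eq_sum {G : Type} [Group G] [Finite G] (n : ℕ) :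
    ∀ (V : Type) [AddCommGroup V] [Module ℂ V] [FiniteDimensional ℂ V]
      (ρ : Representation ℂ G V), finrank ℂ V = n →
    ∃ (ι : Type) (_ : Fintype ι) (χ : ι → G → ℂ),
      (∀ i, ∃ (W : Type) (_ : AddCommGroup W) (_ : Module ℂ W) (_ : FiniteDimensional ℂ W)
        (σ : Representation ℂ G W), σ.IsIrreducible ∧ χ i = σ.character) ∧
      ρ.character = ∑ i, χ i := by
  induction n using Nat.strong_induction_on with
  | _ n ih =>
  intro V _ _ _ ρ hn
  by_cases hV : Nontrivial V
  swap
  · rw [not_nontrivial_iff_subsingleton] at hV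
    refine ⟨PEmpty, inferInstance, fun _ => 0, nofun, ?_⟩
    funext g
    have : ρ g = 0 := Subsingleton.elim _ _
    simp [Representation.character, this]
  by_cases hirr : ρ.IsIrreducible
  · exact ⟨PUnit, inferInstance, fun _ => ρ.character,
      fun _ => ⟨V, _, _, inferInstance, ρ, hirr, rfl⟩, by simp⟩
  have hne : (⊥ : Subrepresentation ρ) ≠ ⊤ := by
    intro h
    obtain ⟨v, hv⟩ := exists_ne (0 : V)
    have hmem : v ∈ (⊥ : Subrepresentation ρ).toSubmodule := by
      rw [h]; exact Submodule.mem_top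
    exact hv ((Submodule.mem_bot ℂ).1 hmem)
  obtain ⟨σ, hσb, hσt⟩ : ∃ σ : Subrepresentation ρ, σ ≠ ⊥ ∧ σ ≠ ⊤ := by
    by_contra! hcon
    have : Nontrivial (Subrepresentation ρ) := ⟨⊥, ⊤, hne⟩
    exact hirr ⟨fun σ => or_iff_not_imp_left.2 (hcon σ)⟩
  obtain ⟨τ, hτ⟩ := exists_isCompl σ
  have hc : IsCompl σ.toSubmodule τ.toSubmodule := by
    refine IsCompl.of_eq ?_ ?_
    · rw [← Subrepresentation.toSubmodule_inf, hτ.inf_eq_bot]; rfl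
    · rw [← Subrepresentation.toSubmodule_sup, hτ.sup_eq_top]; rfl
  have hσ0 : σ.toSubmodule ≠ ⊥ := fun h => hσb (Subrepresentation.toSubmodule_injective h)
  have hσ1 : σ.toSubmodule ≠ ⊤ := fun h => hσt (Subrepresentation.toSubmodule_injective h)
  have hadd := Submodule.finrank_add_eq_of_isCompl hc
  have hlt := Submodule.finrank_lt hσ1
  have hpos : 0 < finrank ℂ σ.toSubmodule :=
    Nat.pos_of_ne_zero fun h => hσ0 (Submodule.finrank_eq_zero.1 h)
  obtain ⟨ι, _, χ, hχ, hχs⟩ := ih _ (hn ▸ hlt) _ σ.toRepresentation rfl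
  obtain ⟨κ, _, ψ, hψ, hψs⟩ := ih (finrank ℂ τ.toSubmodule) (by lia) _ τ.toRepresentation rfl
  refine ⟨ι ⊕ κ, inferInstance, Sum.elim χ ψ, ?_, ?_⟩
  · rintro (i | i)
    · exact hχ i
    · exact hψ i
  · rw [ρ.character_eq_add_of_isCompl σ τ hc, hχs, hψs, Fintype.sum_sum_type]
    rfl

/-- The regular character, `|G|` at the identity and zero elsewhere, is a finite sum of
irreducible characters. -/
theorem exists_regular_character_eq_sum (G : Type) [Group G] [Fintype G] [DecidableEq G] :
    ∃ (ι : Type) (_ : Fintype ι) (χ : ι → G → ℂ),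
      (∀ i, ∃ (W : Type) (_ : AddCommGroup W) (_ : Module ℂ W) (_ : FiniteDimensional ℂ W)
        (σ : Representation ℂ G W), σ.IsIrreducible ∧ χ i = σ.character) ∧
      ∀ g, ∑ i, χ i g = if g = 1 then (Nat.card G : ℂ) else 0 := by
  let ρ : Representation ℂ G (G → ℂ) :=
    { toFun g := LinearMap.funLeft ℂ ℂ (fun x => g⁻¹ * x)
      map_one' := by ext; simp [LinearMap.funLeft]
      map_mul' a b := by
        apply LinearMap.ext
        intro f
        funext x
        simp [LinearMap.funLeft, mul_assoc] }
  obtain ⟨ι, _, χ, hχ, hs⟩ := Representation.exists_character_eq_sum _ _ ρ rfl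
  refine ⟨ι, inferInstance, χ, hχ, fun g => ?_⟩
  have h1 : ∑ i, χ i g = ρ.character g := by rw [hs, Finset.sum_apply]
  rw [h1, Representation.character, LinearMap.trace_eq_matrix_trace ℂ (Pi.basisFun ℂ G),
    Matrix.trace]
  have h2 : ∀ x : G, (LinearMap.toMatrix (Pi.basisFun ℂ G) (Pi.basisFun ℂ G) (ρ g)).diag x
      = if g = 1 then 1 else 0 := by
    intro x
    simp [ρ, LinearMap.funLeft, Pi.single_apply]
  simp only [h2]
  split_ifs <;> simp

/-- The product formula for values of an irreducible character. -/
lemma Representation.IsIrreducible.sum_character_mul_conj {G V : Type} [Group G] [Fintype G]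
    [AddCommGroup V] [Module ℂ V] [FiniteDimensional ℂ V] (ρ : Representation ℂ G V)
    [ρ.IsIrreducible] (x y : G) :
    (finrank ℂ V : ℂ) * ∑ g : G, ρ.character (x * (g * y * g⁻¹)) =
      Nat.card G * (ρ.character x * ρ.character y) := by
  let f : V →ₗ[ℂ] V := ∑ g : G, ρ (g * y * g⁻¹)
  have hf : ∀ g, f * ρ g = ρ g * f := by
    intro g
    simp only [f, Finset.sum_mul, Finset.mul_sum, ← map_mul]
    refine Fintype.sum_equiv (Equiv.mulLeft g⁻¹) _ _ fun k => ?_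
    simp [mul_assoc]
  obtain ⟨c, hc⟩ := (Representation.IsIrreducible.algebraMap_intertwiningMap_bijective_of_isAlgClosed
    (ρ := ρ)).2 ⟨f, hf⟩
  have hfc : f = c • LinearMap.id := by
    have := congrArg Representation.IntertwiningMap.toLinearMap hc
    rw [Algebra.algebraMap_eq_smul_one] at this
    exact this.symm
  have h1 : (Nat.card G : ℂ) * ρ.character y = c * finrank ℂ V := by
    have : LinearMap.trace ℂ V f = Nat.card G * ρ.character y := by
      have hk : ∀ g, LinearMap.trace ℂ V (ρ (g * y * g⁻¹)) = ρ.character y :=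
        fun g => ρ.char_conj y g
      simp only [f, map_sum, hk]
      simp
    rw [← this, hfc]
    simp
  have h2 : ∑ g : G, ρ.character (x * (g * y * g⁻¹)) = c * ρ.character x := by
    have : LinearMap.trace ℂ V (ρ x * f) = ∑ g : G, ρ.character (x * (g * y * g⁻¹)) := by
      simp only [f, Finset.mul_sum, map_sum, ← map_mul]
      rfl
    rw [← this, hfc, mul_smul_comm, map_smul]
    rfl
  rw [h2]
  linear_combination (-ρ.character x) * h1

lemma Representation.IsIrreducible.isIrrChar {G V : Type} [Group G] [Finite G]
    [AddCommGroup V] [Module ℂ V] [FiniteDimensional ℂ V] (ρ : Representation ℂ G V)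
    [ρ.IsIrreducible] : IsIrrChar G ρ.character := by
  have := Fintype.ofFinite G
  have hcard : (Nat.card G : ℂ) ≠ 0 := Nat.cast_ne_zero.2 Nat.card_pos.ne'
  have := invertibleOfNonzero hcard
  refine ⟨FDRep.of ρ, (FDRep.simple_iff_char_is_norm_one _).2 ?_, rfl⟩
  have h := ρ.char_orthonormal ρ
  rw [if_pos ⟨Representation.Equiv.refl ρ⟩, inv_mul_eq_one₀ hcard] at h
  exact h.symm

lemma IsIrrChar.apply_one_ne_zero {G : Type} [Group G] [Finite G] {α : G → ℂ}
    (hα : IsIrrChar G α) : α 1 ≠ 0 := by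
  have := Fintype.ofFinite G
  obtain ⟨V, hV, rfl⟩ := hα
  rw [FDRep.char_one]
  intro h0
  have hsub : Subsingleton V := finrank_zero_iff.1 (by exact_mod_cast h0)
  have hchar : ∀ g, V.character g = 0 := by
    intro g
    have : V.ρ g = 0 := Subsingleton.elim _ _
    simp [FDRep.character, this]
  have h := (FDRep.simple_iff_char_is_norm_one V).1 hV
  simp only [hchar, mul_zero, Finset.sum_const_zero] at h
  exact Nat.card_pos.ne' (by exact_mod_cast h.symm : Nat.card G = 0)

lemma IsIrrChar.eq_of_sum_ne_zero {G : Type} [Group G] [Fintype G] {α β : G → ℂ}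
    (hα : IsIrrChar G α) (hβ : IsIrrChar G β) (h : ∑ g, α g * β g⁻¹ ≠ 0) : α = β := by
  obtain ⟨V, hV, rfl⟩ := hα
  obtain ⟨W, hW, rfl⟩ := hβ
  have hcard : (Nat.card G : ℂ) ≠ 0 := Nat.cast_ne_zero.2 Nat.card_pos.ne'
  have := invertibleOfNonzero hcard
  have ho := FDRep.char_orthonormal V W
  split_ifs at ho with hi
  · exact FDRep.char_iso hi.some
  · exact absurd ho (mul_ne_zero (inv_ne_zero hcard) h)

/-- If a weighted sum of irreducible characters is the regular character, then every irreducible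
character occurs in it. -/
lemma IsIrrChar.exists_eq_of_sum_eq_regular {G ι : Type} [Group G] [Fintype G] [DecidableEq G]
    [Fintype ι] {χ : ι → G → ℂ} (hχ : ∀ i, IsIrrChar G (χ i)) (w : ι → ℂ)
    (hreg : ∀ g, ∑ i, w i * χ i g = if g = 1 then (Nat.card G : ℂ) else 0)
    {α : G → ℂ} (hα : IsIrrChar G α) : ∃ i, χ i = α := by
  have hcard : (Nat.card G : ℂ) ≠ 0 := Nat.cast_ne_zero.2 Nat.card_pos.ne'
  have hsum : ∑ i, w i * ∑ g, χ i g * α g⁻¹ = Nat.card G * α 1 := by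
    calc ∑ i, w i * ∑ g, χ i g * α g⁻¹ = ∑ g, (∑ i, w i * χ i g) * α g⁻¹ := by
          simp only [Finset.mul_sum, Finset.sum_mul, mul_assoc]
          exact Finset.sum_comm
      _ = Nat.card G * α 1 := by simp [hreg]
  obtain ⟨i, -, hi⟩ := Finset.exists_ne_zero_of_sum_ne_zero
    (hsum ▸ mul_ne_zero hcard hα.apply_one_ne_zero)
  exact ⟨i, (hχ i).eq_of_sum_ne_zero hα (right_ne_zero_of_mul hi)⟩

/-- Column orthogonality for a finite family that contains every irreducible character. -/
theorem exists_irrChar_column_orthogonality (G : Type) [Group G] [Fintype G] [DecidableEq G] :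
    ∃ (ι : Type) (_ : Fintype ι) (χ : ι → G → ℂ) (d : ι → ℕ),
      (∀ i, IsIrrChar G (χ i)) ∧ (∀ i, 0 < d i) ∧ (∀ α, IsIrrChar G α → ∃ i, χ i = α) ∧
      ∀ x y, ∑ i, (d i : ℂ)⁻¹ * (χ i x * χ i y) =
        ∑ g : G, if x * (g * y * g⁻¹) = 1 then 1 else 0 := by
  obtain ⟨ι, _, χ, hχ, hreg⟩ := exists_regular_character_eq_sum G
  have hirr : ∀ i, IsIrrChar G (χ i) := by
    intro i
    obtain ⟨W, _, _, _, σ, hσ, he⟩ := hχ i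
    rw [he]
    exact Representation.IsIrreducible.isIrrChar σ
  have hd : ∀ i, ∃ d : ℕ, 0 < d ∧ ∀ x y, (d : ℂ) * ∑ g : G, χ i (x * (g * y * g⁻¹)) =
      Nat.card G * (χ i x * χ i y) := by
    intro i
    have h1 := (hirr i).apply_one_ne_zero
    obtain ⟨W, _, _, _, σ, hσ, he⟩ := hχ i
    rw [he, Representation.char_one, Nat.cast_ne_zero] at h1
    refine ⟨finrank ℂ W, Nat.pos_of_ne_zero h1, fun x y => ?_⟩
    rw [he]
    exact Representation.IsIrreducible.sum_character_mul_conj σ x y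
  choose d hd0 hd using hd
  refine ⟨ι, inferInstance, χ, d, hirr, hd0, fun α hα =>
    hα.exists_eq_of_sum_eq_regular hirr (fun _ => 1) (by simpa using hreg), fun x y => ?_⟩
  have hcard : (Nat.card G : ℂ) ≠ 0 := Nat.cast_ne_zero.2 Nat.card_pos.ne'
  apply mul_left_cancel₀ hcard
  calc (Nat.card G : ℂ) * ∑ i, (d i : ℂ)⁻¹ * (χ i x * χ i y)
      = ∑ i, ∑ g : G, χ i (x * (g * y * g⁻¹)) := by
        rw [Finset.mul_sum]
        refine Finset.sum_congr rfl fun i _ => ?_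
        have : (d i : ℂ) ≠ 0 := Nat.cast_ne_zero.2 (hd0 i).ne'
        rw [mul_left_comm, ← hd, inv_mul_cancel_left₀ this]
    _ = ∑ g : G, ∑ i, χ i (x * (g * y * g⁻¹)) := Finset.sum_comm
    _ = _ := by simp only [hreg, Finset.mul_sum, mul_ite, mul_one, mul_zero]

lemma IsIrrChar.apply_conj {G : Type} [Group G] {α : G → ℂ} (hα : IsIrrChar G α) (x g : G) :
    α (g * x * g⁻¹) = α x := by
  obtain ⟨V, -, rfl⟩ := hα
  exact V.char_conj x g

section Linked

variable {G : Type} [Group G] [Fintype G] (H : Subgroup G) [DecidablePred (· ∈ H)]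

/-- The unnormalised inner product of `a` and the conjugate of `b` by `g` on `H ∩ g⁻¹Hg`. -/
def mackeySum (a b : G → ℤ) (g : G) : ℤ :=
  ∑ h : H, if g * h * g⁻¹ ∈ H then a h * b (g * h * g⁻¹) else 0

variable {H}

/-- The multiplicity of an irreducible constituent is a natural number. -/
lemma exists_sum_mul_eq_natCast {χ : G → ℂ} (hχ : IsIrrChar G χ) {a : G → ℤ}
    (ha : IsIrrChar H (fun h => (a h : ℂ))) (hai : ∀ h ∈ H, a h⁻¹ = a h) :
    ∃ n : ℕ, ∑ h : H, χ h * a h = n := by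
  obtain ⟨V, -, rfl⟩ := hχ
  obtain ⟨W, -, hW⟩ := ha
  have hcard : (Nat.card H : ℂ) ≠ 0 := Nat.cast_ne_zero.2 Nat.card_pos.ne'
  have := invertibleOfNonzero hcard
  have h := FDRep.scalar_product_char_eq_finrank_equivariant W
    (FDRep.of ((V.ρ : Representation ℂ G V).comp H.subtype) : FDRep ℂ H)
  rw [inv_mul_eq_iff_eq_mul₀ hcard] at h
  rw [← Nat.cast_mul] at h
  refine ⟨_, (Finset.sum_congr rfl fun x _ => ?_).trans h⟩
  rw [← hW, ← hai x x.2]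
  rfl

lemma charInner_resChar_ne_zero_iff (χ : G → ℂ) (a : G → ℤ) :
    charInner H (resChar H χ) (fun h => (a h : ℂ)) ≠ 0 ↔ ∑ h : H, χ h * a h ≠ 0 := by
  rw [charInner, finsum_eq_sum_of_fintype]
  simp [resChar]

/-- Integer-valued irreducible characters of `H` are linked over `G` if and only if the sum of
their Mackey sums over `G` does not vanish. -/
theorem linked_iff_sum_mackeySum_ne_zero {a b : G → ℤ} (ha : IsIrrChar H (fun h => (a h : ℂ)))
    (hai : ∀ h ∈ H, a h⁻¹ = a h) (hb : IsIrrChar H (fun h => (b h : ℂ)))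
    (hbi : ∀ h ∈ H, b h⁻¹ = b h) :
    Linked H (fun h => (a h : ℂ)) (fun h => (b h : ℂ)) ↔ ∑ g : G, mackeySum H a b g ≠ 0 := by
  classical
  obtain ⟨ι, _, χ, d, hirr, hd, hall, hcol⟩ := exists_irrChar_column_orthogonality G
  choose m hm using fun i => exists_sum_mul_eq_natCast (hirr i) ha hai
  choose n hn using fun i => exists_sum_mul_eq_natCast (hirr i) hb hbi
  have hlink : Linked H (fun h => (a h : ℂ)) (fun h => (b h : ℂ)) ↔ ∃ i, m i ≠ 0 ∧ n i ≠ 0 := by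
    simp only [Linked, charInner_resChar_ne_zero_iff]
    constructor
    · rintro ⟨ψ, hψ, h1, h2⟩
      obtain ⟨i, rfl⟩ := hall ψ hψ
      rw [hm, Nat.cast_ne_zero] at h1
      rw [hn, Nat.cast_ne_zero] at h2
      exact ⟨i, h1, h2⟩
    · rintro ⟨i, h1, h2⟩
      exact ⟨χ i, hirr i, by rwa [hm, Nat.cast_ne_zero], by rwa [hn, Nat.cast_ne_zero]⟩
  have hinner : ∀ (g : G) (h : H), (∑ k : H, if (k : G) * (g * h * g⁻¹) = 1 then b k else 0) =
      if g * h * g⁻¹ ∈ H then b (g * h * g⁻¹) else 0 := by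
    intro g h
    split_ifs with hmem
    · rw [Finset.sum_eq_single (⟨g * h * g⁻¹, hmem⟩⁻¹ : H)]
      · exact (if_pos (inv_mul_cancel (g * (h : G) * g⁻¹))).trans (hbi _ hmem)
      · intro k _ hk
        refine if_neg fun h1 => hk ?_
        exact Subtype.ext (eq_inv_of_mul_eq_one_left h1)
      · simp
    · refine Finset.sum_eq_zero fun k _ => if_neg fun h1 => hmem ?_
      rw [eq_inv_of_mul_eq_one_right h1]
      exact H.inv_mem k.2
  have hsum : ((∑ g : G, mackeySum H a b g : ℤ) : ℂ) = ∑ i, (d i : ℂ)⁻¹ * (m i * n i) := by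
    calc ((∑ g : G, mackeySum H a b g : ℤ) : ℂ)
        = ((∑ g : G, ∑ h : H, ∑ k : H,
            a h * if (k : G) * (g * h * g⁻¹) = 1 then b k else 0 : ℤ) : ℂ) := by
          congr 1
          refine Finset.sum_congr rfl fun g _ => Finset.sum_congr rfl fun h _ => ?_
          rw [← Finset.mul_sum, hinner, mul_ite, mul_zero]
      _ = ∑ h : H, ∑ k : H, (a h : ℂ) * (b k : ℂ) *
            ∑ g : G, if (k : G) * (g * h * g⁻¹) = 1 then (1 : ℂ) else 0 := by
          rw [Finset.sum_comm]
          push_cast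
          refine Finset.sum_congr rfl fun h _ => ?_
          rw [Finset.sum_comm]
          refine Finset.sum_congr rfl fun k _ => ?_
          rw [Finset.mul_sum]
          refine Finset.sum_congr rfl fun g _ => ?_
          split_ifs <;> simp
      _ = ∑ i, (d i : ℂ)⁻¹ * ((∑ h : H, χ i h * a h) * ∑ k : H, χ i k * b k) := by
          symm
          simp_rw [Finset.sum_mul_sum]
          conv_lhs => simp only [Finset.mul_sum]
          rw [Finset.sum_comm]
          refine Finset.sum_congr rfl fun h _ => ?_
          rw [Finset.sum_comm]
          refine Finset.sum_congr rfl fun k _ => ?_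
          rw [← hcol, Finset.mul_sum]
          exact Finset.sum_congr rfl fun i _ => by ring
      _ = _ := by simp only [hm, hn]
  have hreal : ((∑ g : G, mackeySum H a b g : ℤ) : ℝ) = ∑ i, (d i : ℝ)⁻¹ * (m i * n i) := by
    apply Complex.ofReal_injective
    push_cast
    exact_mod_cast hsum
  rw [hlink, ← Int.cast_ne_zero (α := ℝ), hreal, Ne,
    Finset.sum_eq_zero_iff_of_nonneg (fun i _ => by positivity)]
  simp [(hd _).ne']

/-- The Mackey sum is constant on double cosets of `H`. -/
lemma mackeySum_mul_mul {a b : G → ℤ} (ha : IsIrrChar H (fun h => (a h : ℂ)))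
    (hb : IsIrrChar H (fun h => (b h : ℂ))) (g : G) {k l : G} (hk : k ∈ H) (hl : l ∈ H) :
    mackeySum H a b (k * g * l) = mackeySum H a b g := by
  have hac : ∀ x ∈ H, a (l * x * l⁻¹) = a x := fun x hx => by
    exact_mod_cast ha.apply_conj ⟨x, hx⟩ ⟨l, hl⟩
  have hbc : ∀ x ∈ H, b (k * x * k⁻¹) = b x := fun x hx => by
    exact_mod_cast hb.apply_conj ⟨x, hx⟩ ⟨k, hk⟩
  refine Fintype.sum_equiv (MulAut.conj (⟨l, hl⟩ : H)).toEquiv _ _ fun x => ?_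
  have hx : k * g * l * x * (k * g * l)⁻¹ = k * (g * (l * x * l⁻¹) * g⁻¹) * k⁻¹ := by group
  have hmem : k * (g * (l * x * l⁻¹) * g⁻¹) * k⁻¹ ∈ H ↔ g * (l * x * l⁻¹) * g⁻¹ ∈ H := by
    rw [H.mul_mem_cancel_right (H.inv_mem hk), H.mul_mem_cancel_left hk]
  change _ = if g * (l * x * l⁻¹) * g⁻¹ ∈ H then
    a (l * x * l⁻¹) * b (g * (l * x * l⁻¹) * g⁻¹) else 0
  rw [hx, if_congr hmem rfl rfl]
  split_ifs with h1
  · rw [hbc _ h1, hac _ x.2]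
  · rfl

end Linked

/-- An integral matrix representation whose character has norm one is irreducible. -/
lemma isIrrChar_of_matrix {G : Type} [Group G] [Fintype G] {n : ℕ}
    (M : G →* Matrix (Fin n) (Fin n) ℤ)
    (hM : ∑ g, (M g).trace * (M g⁻¹).trace = Nat.card G) :
    IsIrrChar G (fun g => ((M g).trace : ℂ)) := by
  let ρ : Representation ℂ G (Fin n → ℂ) :=
    (Matrix.toLinAlgEquiv' : Matrix (Fin n) (Fin n) ℂ ≃ₐ[ℂ] _).toAlgHom.toMonoidHom.comp
      ((Int.castRingHom ℂ).mapMatrix.toMonoidHom.comp M)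
  have hρ : ∀ g, (FDRep.of ρ).character g = ((M g).trace : ℂ) := by
    intro g
    change LinearMap.trace ℂ _ (Matrix.toLin' ((M g).map (Int.cast : ℤ → ℂ))) = _
    rw [Matrix.trace_toLin'_eq]
    simp [Matrix.trace]
  refine ⟨FDRep.of ρ, (FDRep.simple_iff_char_is_norm_one _).2 ?_, funext fun g => (hρ g).symm⟩
  simp only [hρ]
  exact_mod_cast hM

open Equiv

/-- `g` maps each of the blocks `{0,1}, {2,3}, {4,5}` to a block. -/
abbrev IsBlockPerm (g : Perm (Fin 6)) : Prop :=
  (g 0 : ℕ) / 2 = (g 1 : ℕ) / 2 ∧ (g 2 : ℕ) / 2 = (g 3 : ℕ) / 2 ∧ (g 4 : ℕ) / 2 = (g 5 : ℕ) / 2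

/-- The matrix whose `j`-th column is the vector attached to the image of `p j` under `g`. -/
def columnMatrix {n : ℕ} (v : Fin 6 → Fin n → ℤ) (p : Fin n → Fin 6) (g : Perm (Fin 6)) :
    Matrix (Fin n) (Fin n) ℤ :=
  Matrix.of fun i j => v (g (p j)) i

/-- The two points of a block, as opposite coordinate vectors. -/
def signVec : Fin 6 → Fin 3 → ℤ :=
  ![![1, 0, 0], ![-1, 0, 0], ![0, 1, 0], ![0, -1, 0], ![0, 0, 1], ![0, 0, -1]]

/-- The three blocks, as vectors of sum zero spanning a plane. -/
def blockVec : Fin 6 → Fin 2 → ℤ :=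
  ![![1, 0], ![1, 0], ![0, 1], ![0, 1], ![-1, -1], ![-1, -1]]

/-- The action of a block permutation by signed permutation matrices. -/
def signMat : Perm (Fin 6) → Matrix (Fin 3) (Fin 3) ℤ := columnMatrix signVec ![0, 2, 4]

/-- The two-dimensional representation of the symmetric group of the blocks. -/
def blockMat : Perm (Fin 6) → Matrix (Fin 2) (Fin 2) ℤ := columnMatrix blockVec ![0, 2]

/-- The determinant of `signMat g`. -/
def signDet (g : Perm (Fin 6)) : ℤ :=
  signMat g 0 0 * signMat g 1 1 * signMat g 2 2 - signMat g 0 0 * signMat g 1 2 * signMat g 2 1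
    - signMat g 0 1 * signMat g 1 0 * signMat g 2 2 + signMat g 0 1 * signMat g 1 2 * signMat g 2 0
    + signMat g 0 2 * signMat g 1 0 * signMat g 2 1 - signMat g 0 2 * signMat g 1 1 * signMat g 2 0

/-- The determinant of `blockMat g`, i.e. the sign of the permutation of the blocks. -/
def blockDet (g : Perm (Fin 6)) : ℤ :=
  blockMat g 0 0 * blockMat g 1 1 - blockMat g 0 1 * blockMat g 1 0

/-- The linear characters of the group of block permutations. -/
def twist (p q : Bool) (g : Perm (Fin 6)) : ℤ :=
  (bif p then blockDet g else 1) * bif q then signDet g else 1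

/-- The irreducible characters of the group of block permutations; those of degree two are listed
twice. -/
def irr (i : Fin 3 × Bool × Bool) (g : Perm (Fin 6)) : ℤ :=
  twist i.2.1 i.2.2 g * ![1, (blockMat g).trace, (signMat g).trace] i.1

/-- The block permutations: flips inside the blocks composed with permutations of the blocks. -/
def blockPerm (i : Bool × Bool × Bool × Fin 6) : Perm (Fin 6) :=
  (bif i.1 then swap 0 1 else 1) * (bif i.2.1 then swap 2 3 else 1) *
    (bif i.2.2.1 then swap 4 5 else 1) *
    ![1, swap 0 2 * swap 1 3, swap 0 4 * swap 1 5, swap 2 4 * swap 3 5,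
      swap 0 2 * swap 1 3 * (swap 2 4 * swap 3 5),
      swap 2 4 * swap 3 5 * (swap 0 2 * swap 1 3)] i.2.2.2

/-- Representatives of the double cosets of the group of block permutations. -/
def doubleCosetRep : Fin 3 → Perm (Fin 6) := ![1, swap 1 2, swap 1 2 * swap 3 4]

/-- The Mackey sum of two characters at a double coset representative. -/
def irrMackeySum (i j : Fin 3 × Bool × Bool) (d : Fin 3) : ℤ :=
  ∑ k, if IsBlockPerm (doubleCosetRep d * blockPerm k * (doubleCosetRep d)⁻¹) then
    irr i (blockPerm k) * irr j (doubleCosetRep d * blockPerm k * (doubleCosetRep d)⁻¹) else 0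

lemma irr_norm : ∀ i, ∑ k, irr i (blockPerm k) * irr i (blockPerm k) = 48 := by decide +kernel

lemma irr_inv : ∀ i k, irr i (blockPerm k)⁻¹ = irr i (blockPerm k) := by decide +kernel

lemma irr_regular : ∀ k, ∑ i, (![1, 1, 3] i.1 : ℤ) * irr i (blockPerm k) =
    if blockPerm k = 1 then 48 else 0 := by decide +kernel

lemma irrMackeySum_hub_pos : ∀ i, i ≠ (0, true, true) →
    (∀ d, 0 ≤ irrMackeySum (2, true, false) i d) ∧ ∃ d, irrMackeySum (2, true, false) i d ≠ 0 := by
  decide +kernel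

lemma irrMackeySum_sign_pos :
    (∀ d, 0 ≤ irrMackeySum (2, false, true) (0, true, true) d) ∧
      ∃ d, irrMackeySum (2, false, true) (0, true, true) d ≠ 0 := by
  decide +kernel

lemma irrMackeySum_eq_zero : ∀ i, (∀ d, irrMackeySum (0, false, false) i d = 0) ∨
    ∀ d, irrMackeySum (0, true, true) i d = 0 := by
  decide +kernel

lemma isBlockPerm_blockPerm : ∀ k, IsBlockPerm (blockPerm k) := by decide +kernel

lemma blockPerm_injective : ∀ k l, blockPerm k = blockPerm l → k = l := by decide +kernel

lemma signMat_mulVec : ∀ k x, (signMat (blockPerm k)).mulVec (signVec x) =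
    signVec (blockPerm k x) := by decide +kernel

lemma blockMat_mulVec : ∀ k x, (blockMat (blockPerm k)).mulVec (blockVec x) =
    blockVec (blockPerm k x) := by decide +kernel

lemma exists_blockPerm_apply : ∀ x y : Fin 6, x ≠ y →
    ∃ k, blockPerm k x = 0 ∧ (blockPerm k y = 1 ∨ blockPerm k y = 2) := by decide +kernel

lemma exists_doubleCosetRep_of_apply : ∀ g : Perm (Fin 6), g 0 = 0 → g 1 = 1 ∨ g 1 = 2 →
    ∃ k d, IsBlockPerm ((doubleCosetRep d)⁻¹ * blockPerm k * g) := by decide +kernel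

lemma exists_blockPerm_eq : ∀ g : Perm (Fin 6), IsBlockPerm g → ∃ k, blockPerm k = g := by
  decide +kernel

lemma forall_exists_image_block_eq_iff : ∀ g : Perm (Fin 6), (∀ j : Fin 3, ∃ l : Fin 3,
      Finset.image (⇑g) (Finset.filter (fun i : Fin 6 => (i : ℕ) / 2 = (j : ℕ)) Finset.univ)
        = Finset.filter (fun i : Fin 6 => (i : ℕ) / 2 = (l : ℕ)) Finset.univ) ↔ IsBlockPerm g := by
  decide +kernel

lemma irrMackeySum_trivial_sign : ∀ d, irrMackeySum (0, false, false) (0, true, true) d = 0 := by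
  decide +kernel

lemma columnMatrix_mul {n : ℕ} {v : Fin 6 → Fin n → ℤ} {p : Fin n → Fin 6} {g : Perm (Fin 6)}
    (hg : ∀ x, (columnMatrix v p g).mulVec (v x) = v (g x)) (h : Perm (Fin 6)) :
    columnMatrix v p (g * h) = columnMatrix v p g * columnMatrix v p h := by
  ext i j
  exact (congrFun (hg (h (p j))) i).symm

lemma signMat_mul (k) (h : Perm (Fin 6)) :
    signMat (blockPerm k * h) = signMat (blockPerm k) * signMat h :=
  columnMatrix_mul (signMat_mulVec k) h

lemma blockMat_mul (k) (h : Perm (Fin 6)) :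
    blockMat (blockPerm k * h) = blockMat (blockPerm k) * blockMat h :=
  columnMatrix_mul (blockMat_mulVec k) h

lemma twist_mul (p q : Bool) (k) (h : Perm (Fin 6)) :
    twist p q (blockPerm k * h) = twist p q (blockPerm k) * twist p q h := by
  have hs : ∀ g, signDet g = (signMat g).det := fun g => (Matrix.det_fin_three _).symm
  have hb : ∀ g, blockDet g = (blockMat g).det := fun g => (Matrix.det_fin_two _).symm
  have hs' : signDet (blockPerm k * h) = signDet (blockPerm k) * signDet h := by
    rw [hs, hs, hs, signMat_mul, Matrix.det_mul]
  have hb' : blockDet (blockPerm k * h) = blockDet (blockPerm k) * blockDet h := by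
    rw [hb, hb, hb, blockMat_mul, Matrix.det_mul]
  cases p <;> cases q <;> simp only [twist, cond_true, cond_false, hs', hb'] <;> ring

lemma twist_one : ∀ p q, twist p q 1 = 1 := by decide +kernel

lemma signMat_one : signMat 1 = 1 := by decide +kernel

lemma blockMat_one : blockMat 1 = 1 := by decide +kernel

section BlockGroup

variable {H : Subgroup (Perm (Fin 6))}
lemma exists_blockPerm_eq_of_mem (hH : ∀ g, g ∈ H ↔ IsBlockPerm g)
    {g : Perm (Fin 6)} (hg : g ∈ H) : ∃ k, blockPerm k = g :=
  exists_blockPerm_eq g ((hH g).1 hg)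

/-- The enumeration of the group of block permutations. -/
def blockEquiv (hH : ∀ g, g ∈ H ↔ IsBlockPerm g) : (Bool × Bool × Bool × Fin 6) ≃ H :=
  Equiv.ofBijective (fun k => ⟨blockPerm k, (hH _).2 (isBlockPerm_blockPerm k)⟩)
    ⟨fun _ _ h => blockPerm_injective _ _ (congrArg Subtype.val h), fun h => by
      obtain ⟨k, hk⟩ := exists_blockPerm_eq_of_mem hH h.2
      exact ⟨k, Subtype.ext hk⟩⟩

lemma sum_eq_sum_blockPerm (hH : ∀ g, g ∈ H ↔ IsBlockPerm g) [Fintype H] (F : Perm (Fin 6) → ℤ) :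
    ∑ h : H, F h = ∑ k, F (blockPerm k) :=
  (Fintype.sum_equiv (blockEquiv hH) _ _ fun _ => rfl).symm

lemma card_eq (hH : ∀ g, g ∈ H ↔ IsBlockPerm g) : Nat.card H = 48 := by
  rw [← Nat.card_congr (blockEquiv hH)]
  simp

lemma irr_inv_of_mem (hH : ∀ g, g ∈ H ↔ IsBlockPerm g)
    (i) (g : Perm (Fin 6)) (hg : g ∈ H) : irr i g⁻¹ = irr i g := by
  obtain ⟨k, rfl⟩ := exists_blockPerm_eq_of_mem hH hg
  exact irr_inv i k

lemma isIrrChar_irr_of_matrix (hH : ∀ g, g ∈ H ↔ IsBlockPerm g)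
    (i) {n : ℕ} {N : Perm (Fin 6) → Matrix (Fin n) (Fin n) ℤ}
    (hN1 : N 1 = 1) (hN : ∀ k h, N (blockPerm k * h) = N (blockPerm k) * N h)
    (hi : ∀ g, irr i g = twist i.2.1 i.2.2 g * (N g).trace) :
    IsIrrChar H (fun h => (irr i h : ℂ)) := by
  have := Fintype.ofFinite H
  let M : H →* Matrix (Fin n) (Fin n) ℤ :=
    { toFun h := twist i.2.1 i.2.2 h • N h
      map_one' := by simp [twist_one, hN1]
      map_mul' g h := by
        obtain ⟨k, hk⟩ := exists_blockPerm_eq_of_mem hH g.2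
        rw [Subgroup.coe_mul, ← hk, hN, twist_mul, smul_mul_smul_comm] }
  have hM : ∀ h : H, (M h).trace = irr i h := fun h => by
    rw [hi]
    exact Matrix.trace_smul _ _
  have h := isIrrChar_of_matrix M (by
    simp only [hM, Subgroup.coe_inv, irr_inv_of_mem hH i _ (Subtype.prop _)]
    rw [sum_eq_sum_blockPerm hH (fun g => irr i g * irr i g), irr_norm, card_eq hH]
    rfl)
  simpa only [hM] using h

lemma isIrrChar_irr (hH : ∀ g, g ∈ H ↔ IsBlockPerm g)
    (i) : IsIrrChar H (fun h => (irr i h : ℂ)) := by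
  obtain ⟨i, p, q⟩ := i
  fin_cases i
  · exact isIrrChar_irr_of_matrix hH _ (N := fun _ => (1 : Matrix (Fin 1) (Fin 1) ℤ)) rfl
      (fun _ _ => (one_mul _).symm) (fun _ => by simp [irr])
  · exact isIrrChar_irr_of_matrix hH _ blockMat_one blockMat_mul (fun _ => rfl)
  · exact isIrrChar_irr_of_matrix hH _ signMat_one signMat_mul (fun _ => rfl)

lemma exists_irr_eq (hH : ∀ g, g ∈ H ↔ IsBlockPerm g)
    {α : H → ℂ} (hα : IsIrrChar H α) : ∃ i, (fun h : H => (irr i h : ℂ)) = α := by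
  classical
  have := Fintype.ofFinite H
  refine hα.exists_eq_of_sum_eq_regular (isIrrChar_irr hH) (fun i => ((![1, 1, 3] i.1 : ℤ) : ℂ))
    fun h => ?_
  obtain ⟨k, hk⟩ := exists_blockPerm_eq_of_mem hH h.2
  have h1 := irr_regular k
  rw [hk] at h1
  rw [card_eq hH, if_congr (Subtype.ext_iff (a2 := (1 : H))) rfl rfl, OneMemClass.coe_one]
  exact_mod_cast congrArg (Int.cast : ℤ → ℂ) h1

lemma exists_eq_mul_doubleCosetRep_mul (hH : ∀ g, g ∈ H ↔ IsBlockPerm g) (g : Perm (Fin 6)) :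
    ∃ d, ∃ k ∈ H, ∃ l ∈ H, g = k * doubleCosetRep d * l := by
  obtain ⟨k, hk0, hk1⟩ := exists_blockPerm_apply (g 0) (g 1) (g.injective.ne (by decide))
  obtain ⟨l, d, hld⟩ := exists_doubleCosetRep_of_apply (blockPerm k * g) hk0 hk1
  have hmem : ∀ k, blockPerm k ∈ H := fun k => (hH _).2 (isBlockPerm_blockPerm k)
  exact ⟨d, _, H.inv_mem (H.mul_mem (hmem l) (hmem k)), _, (hH _).2 hld, by group⟩

lemma mackeySum_doubleCosetRep (hH : ∀ g, g ∈ H ↔ IsBlockPerm g)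
    [DecidablePred (· ∈ H)] (i j) (d : Fin 3) :
    mackeySum H (irr i) (irr j) (doubleCosetRep d) = irrMackeySum i j d := by
  refine (sum_eq_sum_blockPerm hH fun h => if doubleCosetRep d * h * (doubleCosetRep d)⁻¹ ∈ H then
    irr i h * irr j (doubleCosetRep d * h * (doubleCosetRep d)⁻¹) else 0).trans
    (Finset.sum_congr rfl fun k _ => ?_)
  exact if_congr (hH _) rfl rfl

lemma exists_mackeySum_eq (hH : ∀ g, g ∈ H ↔ IsBlockPerm g)
    [DecidablePred (· ∈ H)] (i j) (g : Perm (Fin 6)) :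
    ∃ d, mackeySum H (irr i) (irr j) g = irrMackeySum i j d := by
  obtain ⟨d, k, hk, l, hl, rfl⟩ := exists_eq_mul_doubleCosetRep_mul hH g
  exact ⟨d, (mackeySum_mul_mul (isIrrChar_irr hH i) (isIrrChar_irr hH j) _ hk hl).trans
    (mackeySum_doubleCosetRep hH i j d)⟩

lemma linked_irr_of_pos (hH : ∀ g, g ∈ H ↔ IsBlockPerm g) {i j} (hpos : ∀ d, 0 ≤ irrMackeySum i j d)
    (hne : ∃ d, irrMackeySum i j d ≠ 0) :
    Linked H (fun h => (irr i h : ℂ)) (fun h => (irr j h : ℂ)) := by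
  classical
  rw [linked_iff_sum_mackeySum_ne_zero (isIrrChar_irr hH i) (irr_inv_of_mem hH i)
    (isIrrChar_irr hH j) (irr_inv_of_mem hH j), Ne, Finset.sum_eq_zero_iff_of_nonneg]
  · obtain ⟨d, hd⟩ := hne
    exact fun h => hd (mackeySum_doubleCosetRep hH i j d ▸ h _ (Finset.mem_univ _))
  · intro g _
    obtain ⟨d, hd⟩ := exists_mackeySum_eq hH i j g
    exact hd ▸ hpos d

lemma not_linked_irr (hH : ∀ g, g ∈ H ↔ IsBlockPerm g) {i j} (hzero : ∀ d, irrMackeySum i j d = 0) :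
    ¬ Linked H (fun h => (irr i h : ℂ)) (fun h => (irr j h : ℂ)) := by
  classical
  rw [linked_iff_sum_mackeySum_ne_zero (isIrrChar_irr hH i) (irr_inv_of_mem hH i)
    (isIrrChar_irr hH j) (irr_inv_of_mem hH j), not_not]
  refine Finset.sum_eq_zero fun g _ => ?_
  obtain ⟨d, hd⟩ := exists_mackeySum_eq hH i j g
  rw [hd, hzero]

end BlockGroup

lemma Linked.symm {G : Type} [Group G] {H : Subgroup G} {α β : H → ℂ} (h : Linked H α β) :
    Linked H β α := by
  obtain ⟨χ, hχ, hα, hβ⟩ := h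
  exact ⟨χ, hχ, hβ, hα⟩

lemma linkedPathLE_refl {G : Type} [Group G] {H : Subgroup G} {α : H → ℂ} (m : ℕ)
    (hα : IsIrrChar H α) : LinkedPathLE H m α α :=
  ⟨0, m.zero_le, fun _ => α, rfl, rfl, fun _ _ => hα, nofun⟩

lemma LinkedPathLE.mono {G : Type} [Group G] {H : Subgroup G} {α β : H → ℂ} {m n : ℕ}
    (h : LinkedPathLE H m α β) (hmn : m ≤ n) : LinkedPathLE H n α β := by
  obtain ⟨k, hk, h⟩ := h
  exact ⟨k, hk.trans hmn, h⟩

lemma LinkedPathLE.cons {G : Type} [Group G] {H : Subgroup G} {α β γ : H → ℂ} {m : ℕ}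
    (hα : IsIrrChar H α) (hl : Linked H α β) (h : LinkedPathLE H m β γ) :
    LinkedPathLE H (m + 1) α γ := by
  obtain ⟨k, hk, f, rfl, hk', hf, hlf⟩ := h
  refine ⟨k + 1, by lia, fun i => i.casesOn α f, rfl, hk', ?_, ?_⟩
  · rintro (_ | i) hi
    · exact hα
    · exact hf i (by lia)
  · rintro (_ | i) hi
    · exact hl
    · exact hlf i (by lia)

lemma LinkedPathLE.symm {G : Type} [Group G] {H : Subgroup G} {α β : H → ℂ} {m : ℕ}
    (h : LinkedPathLE H m α β) : LinkedPathLE H m β α := by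
  obtain ⟨k, hk, f, h0, hk', hf, hl⟩ := h
  refine ⟨k, hk, fun i => f (k - i), by simpa using hk', by simpa using h0,
    fun i _ => hf _ (by lia), fun i hi => ?_⟩
  have := hl (k - (i + 1)) (by lia)
  rw [show k - (i + 1) + 1 = k - i by lia] at this
  exact this.symm

/-- Let `G = S₆` and let `H ≅ S₂ ≀ S₃` (of order 48) be the stabilizer
of the partition of `{0,…,5}` into the three blocks `{0,1}, {2,3}, {4,5}`. Then the
Külshammer graph `K(G,H)` has diameter exactly 3 (equivalently, `d_G(H) = 7`). -/
theorem kulshammer_S6_imprimitive (H : Subgroup (Equiv.Perm (Fin 6)))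
    (hH : ∀ g : Equiv.Perm (Fin 6), g ∈ H ↔ ∀ j : Fin 3, ∃ l : Fin 3,
      Finset.image (⇑g) (Finset.filter (fun i : Fin 6 => (i : ℕ) / 2 = (j : ℕ)) Finset.univ)
        = Finset.filter (fun i : Fin 6 => (i : ℕ) / 2 = (l : ℕ)) Finset.univ) :
    (∀ α β : ↥H → ℂ, IsIrrChar ↥H α → IsIrrChar ↥H β → LinkedPathLE H 3 α β) ∧
    (∃ α β : ↥H → ℂ, IsIrrChar ↥H α ∧ IsIrrChar ↥H β ∧ ¬ LinkedPathLE H 2 α β) := by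
  replace hH g := (hH g).trans (forall_exists_image_block_eq_iff g)
  have hirr := isIrrChar_irr hH
  have hhub : ∀ i, i ≠ (0, true, true) → Linked H (fun h => (irr (2, true, false) h : ℂ))
      (fun h => (irr i h : ℂ)) := fun i hi =>
    linked_irr_of_pos hH (irrMackeySum_hub_pos i hi).1 (irrMackeySum_hub_pos i hi).2
  have hsign := linked_irr_of_pos hH irrMackeySum_sign_pos.1 irrMackeySum_sign_pos.2
  have hpath : ∀ i, i ≠ (0, true, true) → LinkedPathLE H 1
      (fun h => (irr (2, true, false) h : ℂ)) (fun h => (irr i h : ℂ)) := fun i hi =>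
    (linkedPathLE_refl 0 (hirr i)).cons (hirr _) (hhub i hi)
  have hpath_sign : ∀ i, i ≠ (0, true, true) → LinkedPathLE H 3
      (fun h => (irr (0, true, true) h : ℂ)) (fun h => (irr i h : ℂ)) := fun i hi =>
    ((hpath i hi).cons (hirr _) (hhub (2, false, true) (by decide)).symm).cons (hirr _) hsign.symm
  refine ⟨fun α β hα hβ => ?_, _, _, hirr (0, false, false), hirr (0, true, true), ?_⟩
  · obtain ⟨i, rfl⟩ := exists_irr_eq hH hα
    obtain ⟨j, rfl⟩ := exists_irr_eq hH hβ
    by_cases hi : i = (0, true, true) <;> by_cases hj : j = (0, true, true)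
    · rw [hi, hj]
      exact linkedPathLE_refl 3 (hirr _)
    · exact hi ▸ hpath_sign j hj
    · exact hj ▸ (hpath_sign i hi).symm
    · exact ((hpath j hj).cons (hirr i) (hhub i hi).symm).mono (by decide)
  · have hns : ¬ Linked H (fun h => (irr (0, false, false) h : ℂ))
        (fun h => (irr (0, true, true) h : ℂ)) := not_linked_irr hH irrMackeySum_trivial_sign
    rintro ⟨k, hk, f, h0, hk', hf, hl⟩
    interval_cases k
    · rw [h0] at hk'
      have h1 := hsign.symm
      rcases irrMackeySum_eq_zero (2, false, true) with h | h
      · exact not_linked_irr hH h (hk' ▸ h1)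
      · exact not_linked_irr hH h h1
    · have := hl 0 (by decide)
      rw [h0, hk'] at this
      exact hns this
    · obtain ⟨i, hi⟩ := exists_irr_eq hH (hf 1 (by decide))
      have h1 := hl 0 (by decide)
      have h2 := hl 1 (by decide)
      rw [h0, ← hi] at h1
      rw [hk', ← hi] at h2
      rcases irrMackeySum_eq_zero i with h | h
      · exact not_linked_irr hH h h1
      · exact not_linked_irr hH h h2.symm
end
end
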